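/- For every n ≥ 1, the set of squarefree integers d < 0 such that the class number of ℚ(√d) is at most n is finite. In particular, the class number of ℚ(√d) tends to infinity as d → −∞ through squarefree values. -/

import Mathlib

section
set_option linter.all false

open Complex Filter Topology in
lemma CN.exists_zeta_one : ∃ P : ℂ → ℂ, Differentiable ℂ P ∧ P 1 = 1 ∧
    ∀ s, s ≠ 1 → P s = (s - 1) * riemannZeta s := by
  refine ⟨DirichletCharacter.LFunctionTrivChar₁ 1,
    DirichletCharacter.differentiable_LFunctionTrivChar₁ 1, by simp, fun s hs => ?_⟩
  rw [DirichletCharacter.LFunctionTrivChar₁, Function.update_of_ne hs,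
    DirichletCharacter.LFunctionTrivChar_eq_mul_riemannZeta hs]
  simp

lemma CN.tail_bound (t : ℕ → ℝ) (T lam x B : ℝ) (hT : HasSum t T) (hx : 1 < x)
    (h0 : 1 - lam ≤ t 0) (h1 : ∀ m, -lam * x ^ m ≤ t m)
    (h2 : ∀ m, |t m| ≤ B * (3/4 : ℝ) ^ m) (N : ℕ) (hN : 1 ≤ N) :
    1 - lam * ((x ^ N - 1) / (x - 1)) - 4 * B * (3/4 : ℝ) ^ N ≤ T := by
  have hs := hT.summable
  have e1 := hs.sum_add_tsum_nat_add N
  rw [hT.tsum_eq] at e1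
  have hg : HasSum (fun m : ℕ => B * (3/4 : ℝ) ^ (m + N)) (4 * B * (3/4 : ℝ) ^ N) := by
    have := (hasSum_geometric_of_lt_one (r := (3/4 : ℝ)) (by norm_num) (by norm_num)).mul_left
      (B * (3/4 : ℝ) ^ N)
    have e2 : (fun m : ℕ => B * (3/4 : ℝ) ^ (m + N)) =
        fun m : ℕ => B * (3/4 : ℝ) ^ N * (3/4 : ℝ) ^ m := by
      funext m; rw [pow_add]; ring
    have e3 : 4 * B * (3/4 : ℝ) ^ N = B * (3/4 : ℝ) ^ N * (1 - 3/4)⁻¹ := by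
      rw [show (1 - 3/4 : ℝ)⁻¹ = 4 by norm_num]; ring
    rw [e2, e3]; exact this
  have h3 : -(4 * B * (3/4 : ℝ) ^ N) ≤ ∑' m, t (m + N) := by
    rw [← hg.tsum_eq, ← tsum_neg]
    exact Summable.tsum_le_tsum (fun m => (abs_le.mp (h2 (m + N))).1) hg.summable.neg
      ((summable_nat_add_iff N).mpr hs)
  have h4 : 1 - lam * ((x ^ N - 1) / (x - 1)) ≤ ∑ m ∈ Finset.range N, t m := by
    rw [← geom_sum_eq hx.ne' N]
    obtain ⟨k, rfl⟩ : ∃ k, N = k + 1 := ⟨N - 1, by omega⟩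
    rw [Finset.sum_range_succ' t, Finset.sum_range_succ' (fun i => x ^ i)]
    have : ∑ i ∈ Finset.range k, -lam * x ^ (i + 1) ≤ ∑ i ∈ Finset.range k, t (i + 1) :=
      Finset.sum_le_sum fun i _ => h1 _
    rw [← Finset.mul_sum] at this
    simp only [pow_zero]
    linarith
  linarith

open Complex Filter Topology ComplexOrder in
theorem CN.estermann : ∃ C : ℝ, 1 ≤ C ∧ ∀ (G : ℂ → ℂ) (M : ℝ) (a : ℕ → ℂ),
    Differentiable ℂ G → (∀ s : ℂ, ‖s - 2‖ ≤ 3/2 → ‖G s‖ ≤ M) → (∀ n, 0 ≤ a n) → 1 ≤ a 1 →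
    (∀ s : ℂ, 1 < s.re → LSeriesSummable a s) →
    (∀ s : ℂ, 1 < s.re → LSeries a s = riemannZeta s * G s) →
    ∀ (N : ℕ), 1 ≤ N → ∀ σ : ℝ, 7/8 ≤ σ → σ < 1 →
    1 - (G 1).re * (2 - σ) ^ N / (1 - σ) - C * M * (3/4 : ℝ) ^ N ≤
      (riemannZeta σ * G σ).re := by
  obtain ⟨P, hP, hP1, hPs⟩ := CN.exists_zeta_one
  obtain ⟨C1, hC1⟩ := (isCompact_sphere (2 : ℂ) (3/2)).exists_bound_of_continuousOn
    hP.continuous.continuousOn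
  have hC1' : 0 ≤ C1 := by
    have : (2 + 3/2 : ℂ) ∈ Metric.sphere (2 : ℂ) (3/2) := by simp
    exact (norm_nonneg _).trans (hC1 _ this)
  refine ⟨8 * (C1 + 1), by linarith, ?_⟩
  intro G M a hG hGM ha0 ha1 hsum hL N hN σ hσ1 hσ2
  have hM : 0 ≤ M := (norm_nonneg _).trans (hGM 2 (by norm_num))
  set H := dslope (fun s => P s * G s) 1 with hH
  have hHd : Differentiable ℂ H := by
    rw [← differentiableOn_univ]
    exact (Complex.differentiableOn_dslope (s := Set.univ) (c := (1:ℂ)) univ_mem).mpr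
      (hP.mul hG).differentiableOn
  have hHs : ∀ s, s ≠ 1 → H s = (s - 1)⁻¹ * (P s * G s - G 1) := by
    intro s hs
    rw [hH, dslope_of_ne _ hs, slope_def_field, hP1]
    rw [one_mul, div_eq_inv_mul]
  have hHs' : ∀ s, s ≠ 1 → H s = riemannZeta s * G s - G 1 * (s - 1)⁻¹ := by
    intro s hs
    rw [hHs s hs, hPs s hs]
    have : s - 1 ≠ 0 := sub_ne_zero.mpr hs
    field_simp
  -- bound on the sphere
  have hbd : ∀ z ∈ Metric.sphere (2 : ℂ) (3/2), ‖H z‖ ≤ 2 * ((C1 + 1) * M) := by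
    intro z hz
    have hz' : ‖z - 2‖ = 3/2 := by simpa [dist_eq_norm] using hz
    have h1 : 1/2 ≤ ‖z - 1‖ := by
      have := norm_sub_le (z - 1) (1 : ℂ)
      rw [show z - 1 - 1 = z - 2 by ring, hz'] at this
      norm_num at this ⊢; linarith
    have hz1 : z ≠ 1 := by rintro rfl; norm_num at h1
    rw [hHs z hz1, norm_mul, norm_inv]
    have h2 : ‖z - 1‖⁻¹ ≤ 2 := by
      rw [inv_le_comm₀ (by linarith) (by norm_num)]; linarith
    have h3 : ‖P z * G z - G 1‖ ≤ (C1 + 1) * M := by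
      refine (norm_sub_le _ _).trans ?_
      rw [norm_mul]
      have e1 := hGM z hz'.le
      have e2 := hGM 1 (by norm_num)
      have e3 := hC1 z hz
      nlinarith [mul_le_mul e3 e1 (norm_nonneg _) hC1']
    exact mul_le_mul h2 h3 (norm_nonneg _) (by norm_num)
  have hcauchy : ∀ m : ℕ, ‖iteratedDeriv m H 2‖ ≤ m.factorial * (2 * ((C1 + 1) * M)) / (3/2) ^ m :=
    fun m => norm_iteratedDeriv_le_of_forall_mem_sphere_norm_le m (by norm_num)
      hHd.diffContOnCl hbd
  have habs : LSeries.abscissaOfAbsConv a < ((2 : ℝ) : EReal) := by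
    refine lt_of_le_of_lt (b := ((3/2 : ℝ) : EReal)) ?_ (by exact_mod_cast (by norm_num : (3/2:ℝ) < 2))
    have := (hsum (3/2 : ℝ) (by simp; norm_num)).abscissaOfAbsConv_le
    simpa using this
  -- the iterated derivatives
  have hopen : IsOpen {s : ℂ | 1 < s.re} := isOpen_lt continuous_const continuous_re
  have hiter : ∀ m : ℕ, iteratedDeriv m H 2 =
      iteratedDeriv m (LSeries a) 2 - G 1 * ((-1) ^ m * m.factorial) := by
    intro m
    have hev : H =ᶠ[𝓝 2] (LSeries a - fun s => G 1 * (s - 1)⁻¹) := by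
      filter_upwards [hopen.mem_nhds (show (2:ℂ) ∈ {s : ℂ | 1 < s.re} by simp)] with s hs
      have hs1 : s ≠ 1 := by rintro rfl; simp at hs
      simp only [Pi.sub_apply]
      rw [hHs' s hs1, hL s hs]
    rw [hev.iteratedDeriv_eq]
    have hLa : ContDiffAt ℂ m (LSeries a) 2 := by
      have : DifferentiableOn ℂ (LSeries a) {s : ℂ | 1 < s.re} := by
        refine (LSeries_differentiableOn a).mono ?_
        intro s hs
        obtain ⟨r, hr1, hr2⟩ := exists_between (show 1 < s.re from hs)
        have := (hsum (r : ℝ) (by simpa using hr1)).abscissaOfAbsConv_le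
        refine lt_of_le_of_lt this ?_
        simpa using hr2
      exact (this.contDiffOn hopen).contDiffAt (hopen.mem_nhds (by simp))
    have hiv : ContDiffAt ℂ m (fun s : ℂ => G 1 * (s - 1)⁻¹) 2 := by
      refine contDiffAt_const.mul (ContDiffAt.inv (by fun_prop) (by norm_num))
    rw [iteratedDeriv_sub hLa hiv]
    congr 1
    rw [iteratedDeriv_const_mul_field]
    congr 1
    have := congrFun (iter_deriv_inv_linear_sub (𝕜 := ℂ) m 1 1) 2
    simp only [one_mul] at this
    rw [iteratedDeriv_eq_iterate, this]
    norm_num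
  have halt : ∀ m : ℕ, 0 ≤ ((-1) ^ m * iteratedDeriv m (LSeries a) 2).re := by
    intro m
    have := LSeries.iteratedDeriv_alternating (a := a) (fun n => ha0 n) habs m
    exact (Complex.le_def.mp (by simpa using this)).1
  have hL2 : 1 ≤ (LSeries a 2).re := by
    have h := hsum 2 (by simp)
    have hre : HasSum (fun n => (LSeries.term a 2 n).re) (LSeries a 2).re :=
      Complex.hasSum_re h.hasSum
    have hnn : ∀ n, 0 ≤ (LSeries.term a 2 n).re := by
      intro n
      have : 0 ≤ LSeries.term a 2 n := by
        rw [LSeries.term_def]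
        split_ifs with h0
        · exact le_rfl
        · have := (inv_natCast_cpow_ofReal_pos h0 2).le
          rw [div_eq_mul_inv]
          exact mul_nonneg (ha0 n) (by simpa using this)
      exact (Complex.le_def.mp this).1
    have := le_hasSum hre 1 (fun n _ => hnn n)
    refine le_trans ?_ this
    rw [LSeries.term_def]
    simpa using (Complex.le_def.mp ha1).1
  have htay := Complex.hasSum_re (Complex.hasSum_taylorSeries_of_entire hHd 2 (σ : ℂ))
  set lam := (G 1).re with hlam
  have hform : ∀ m : ℕ, ((m.factorial : ℂ)⁻¹ • ((σ : ℂ) - 2) ^ m • iteratedDeriv m H 2).re =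
      (m.factorial : ℝ)⁻¹ * (2 - σ) ^ m * (((-1) ^ m * iteratedDeriv m H 2).re) := by
    intro m
    have : ((m.factorial : ℂ)⁻¹ • ((σ : ℂ) - 2) ^ m • iteratedDeriv m H 2) =
      (((m.factorial : ℝ)⁻¹ * (2 - σ) ^ m : ℝ) : ℂ) * ((-1) ^ m * iteratedDeriv m H 2) := by
      rw [show ((σ : ℂ) - 2) = (-1) * ((2 - σ : ℝ) : ℂ) by push_cast; ring, mul_pow]
      simp only [smul_eq_mul]
      push_cast
      ring
    rw [this, Complex.re_ofReal_mul]
  have hre2 : ∀ m : ℕ, ((-1) ^ m * iteratedDeriv m H 2).re =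
      ((-1) ^ m * iteratedDeriv m (LSeries a) 2).re - lam * m.factorial := by
    intro m
    rw [hiter m, mul_sub, Complex.sub_re]
    congr 1
    rw [show (-1 : ℂ) ^ m * (G 1 * ((-1) ^ m * m.factorial)) = ((-1) ^ m * (-1) ^ m) *
      ((m.factorial : ℝ) * G 1) by push_cast; ring, ← mul_pow]
    simp only [mul_neg, mul_one, neg_neg, one_pow, one_mul, Complex.re_ofReal_mul]
    rw [mul_comm]
  have hfac : ∀ m : ℕ, (0 : ℝ) < m.factorial := fun m => by exact_mod_cast m.factorial_pos
  have hmain := CN.tail_bound _ _ lam (2 - σ) (2 * ((C1 + 1) * M)) htay (by linarith)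
    (by
      rw [hform 0, hre2 0]
      simp only [Nat.factorial_zero, Nat.cast_one, inv_one, pow_zero, one_mul, mul_one,
        iteratedDeriv_zero]
      linarith)
    (by
      intro m
      rw [hform m, hre2 m, mul_sub]
      have e1 : (m.factorial : ℝ)⁻¹ * (2 - σ) ^ m * (lam * m.factorial) = lam * (2 - σ) ^ m := by
        have := (hfac m).ne'
        field_simp
      rw [e1]
      have : 0 ≤ (m.factorial : ℝ)⁻¹ * (2 - σ) ^ m *
          ((-1) ^ m * iteratedDeriv m (LSeries a) 2).re :=
        mul_nonneg (mul_nonneg (by positivity) (pow_nonneg (by linarith) _)) (halt m)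
      linarith)
    (by
      intro m
      rw [hform m, abs_mul, abs_mul, abs_of_nonneg (pow_nonneg (by linarith : 0 ≤ 2 - σ) m),
        abs_of_pos (inv_pos.mpr (hfac m))]
      have e1 : |((-1) ^ m * iteratedDeriv m H 2).re| ≤
          m.factorial * (2 * ((C1 + 1) * M)) / (3/2) ^ m := by
        refine (Complex.abs_re_le_norm _).trans ?_
        rw [norm_mul]
        simpa using hcauchy m
      have e2 : (2 - σ) ^ m ≤ (9/8 : ℝ) ^ m := pow_le_pow_left₀ (by linarith) (by linarith) m
      calc (m.factorial : ℝ)⁻¹ * (2 - σ) ^ m * |((-1) ^ m * iteratedDeriv m H 2).re|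
          ≤ (m.factorial : ℝ)⁻¹ * (9/8 : ℝ) ^ m *
            (m.factorial * (2 * ((C1 + 1) * M)) / (3/2) ^ m) := by
            gcongr
        _ = 2 * ((C1 + 1) * M) * (3/4 : ℝ) ^ m := by
            have := (hfac m).ne'
            have h98 : (3/4 : ℝ) ^ m = (9/8 : ℝ) ^ m / (3/2 : ℝ) ^ m := by
              rw [← div_pow]; norm_num
            rw [h98]
            generalize (9/8 : ℝ) ^ m = u
            generalize (3/2 : ℝ) ^ m = v
            rw [show (m.factorial : ℝ)⁻¹ * u * (m.factorial * (2 * ((C1 + 1) * M)) / v) =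
              ((m.factorial : ℝ)⁻¹ * m.factorial) * (2 * ((C1 + 1) * M) * (u / v)) by ring,
              inv_mul_cancel₀ this, one_mul])
    N hN
  have hσne : (σ : ℂ) ≠ 1 := by exact_mod_cast hσ2.ne
  rw [hHs' _ hσne, Complex.sub_re] at hmain
  have e3 : (G 1 * ((σ : ℂ) - 1)⁻¹).re = - lam / (1 - σ) := by
    rw [show G 1 * ((σ : ℂ) - 1)⁻¹ = (((σ - 1)⁻¹ : ℝ) : ℂ) * G 1 by push_cast; ring,
      Complex.re_ofReal_mul, ← hlam]
    rw [show σ - 1 = -(1 - σ) by ring, inv_neg]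
    ring
  rw [e3] at hmain
  have e4 : lam * (((2 - σ) ^ N - 1) / (2 - σ - 1)) = lam * (2 - σ) ^ N / (1 - σ) - lam / (1 - σ) := by
    rw [show 2 - σ - 1 = 1 - σ by ring]; ring
  rw [e4] at hmain
  have : - lam / (1 - σ) = -(lam / (1 - σ)) := neg_div _ _
  rw [this] at hmain
  nlinarith [hmain]
end

section
set_option linter.all false

lemma CN.cpow_diff_bound (n : ℕ) (s : ℂ) (hs : 0 < s.re) :
    ‖((n + 1 : ℕ) : ℂ) ^ (-s) - ((n + 2 : ℕ) : ℂ) ^ (-s)‖ ≤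
      ‖s‖ * ((n + 1 : ℕ) : ℝ) ^ (-s.re - 1) := by
  have hder : ∀ x ∈ Set.Icc ((n + 1 : ℕ) : ℝ) ((n + 2 : ℕ) : ℝ),
      HasDerivWithinAt (fun t : ℝ => (t : ℂ) ^ (-s)) (-s * (x : ℂ) ^ (-s - 1))
        (Set.Icc ((n + 1 : ℕ) : ℝ) ((n + 2 : ℕ) : ℝ)) x := by
    intro x hx
    have hx0 : (0 : ℝ) < x := lt_of_lt_of_le (by positivity) hx.1
    refine (hasDerivAt_ofReal_cpow_const hx0.ne' ?_).hasDerivWithinAt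
    intro h
    have := congrArg Complex.re h
    simp at this
    linarith
  have hb : ∀ x ∈ Set.Icc ((n + 1 : ℕ) : ℝ) ((n + 2 : ℕ) : ℝ),
      ‖-s * (x : ℂ) ^ (-s - 1)‖ ≤ ‖s‖ * ((n + 1 : ℕ) : ℝ) ^ (-s.re - 1) := by
    intro x hx
    have hx0 : (0 : ℝ) < x := lt_of_lt_of_le (by positivity) hx.1
    rw [norm_mul, norm_neg, Complex.norm_cpow_eq_rpow_re_of_pos hx0]
    refine mul_le_mul_of_nonneg_left ?_ (norm_nonneg _)
    simp only [Complex.sub_re, Complex.neg_re, Complex.one_re]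
    exact Real.rpow_le_rpow_of_nonpos (by positivity) hx.1 (by linarith)
  have := (convex_Icc ((n + 1 : ℕ) : ℝ) ((n + 2 : ℕ) : ℝ)).norm_image_sub_le_of_norm_hasDerivWithin_le
    hder hb (Set.left_mem_Icc.mpr (by push_cast; linarith))
    (Set.right_mem_Icc.mpr (by push_cast; linarith))
  rw [norm_sub_rev]
  have e : ‖((n + 2 : ℕ) : ℝ) - ((n + 1 : ℕ) : ℝ)‖ = 1 := by
    push_cast; rw [show (n:ℝ) + 2 - (n + 1) = 1 by ring]; simp
  rw [e, mul_one] at this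
  simpa using this

section
variable {q : ℕ} [NeZero q] (χ : DirichletCharacter ℂ q)

noncomputable def CN.psum (n : ℕ) : ℂ := ∑ k ∈ Finset.range n, χ ((k + 1 : ℕ) : ZMod q)

lemma CN.norm_psum_le (n : ℕ) : ‖CN.psum χ n‖ ≤ n := by
  refine (norm_sum_le _ _).trans ?_
  refine (Finset.sum_le_sum (fun k _ => χ.norm_le_one _)).trans ?_
  simp

lemma CN.psum_add (hχ : χ ≠ 1) (n : ℕ) : CN.psum χ (n + q) = CN.psum χ n := by
  have hq : ∑ k ∈ Finset.range q, χ ((k : ℕ) : ZMod q) = 0 := by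
    have h := MulChar.sum_eq_zero_of_ne_one hχ
    rw [← h]
    refine Finset.sum_bij (fun k _ => (k : ZMod q)) (by simp) ?_ ?_ (by simp)
    · intro a ha b hb hab
      simp only [Finset.mem_range] at ha hb
      have := (ZMod.natCast_eq_natCast_iff' a b q).mp hab
      rwa [Nat.mod_eq_of_lt ha, Nat.mod_eq_of_lt hb] at this
    · intro b _
      exact ⟨b.val, by simpa using ZMod.val_lt b, by simp⟩
  induction n with
  | zero =>
    have h1 : CN.psum χ q = ∑ k ∈ Finset.range q, χ ((k : ℕ) : ZMod q) := by
      have e1 := Finset.sum_range_succ (fun k : ℕ => χ ((k : ℕ) : ZMod q)) q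
      have e2 := Finset.sum_range_succ' (fun k : ℕ => χ ((k : ℕ) : ZMod q)) q
      rw [CN.psum]
      rw [e1] at e2
      simp only [CharP.cast_eq_zero, Nat.cast_zero] at e2
      exact (add_right_cancel e2).symm
    rw [zero_add, h1, hq]; simp [CN.psum]
  | succ n ih =>
    rw [show n + 1 + q = (n + q) + 1 by ring]
    unfold CN.psum at ih ⊢
    rw [Finset.sum_range_succ, ih, Finset.sum_range_succ]
    congr 2
    push_cast
    simp

lemma CN.norm_psum_le' (hχ : χ ≠ 1) (n : ℕ) : ‖CN.psum χ n‖ ≤ q := by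
  induction n using Nat.strong_induction_on with
  | _ n ih =>
    rcases lt_or_ge n q with h | h
    · exact (CN.norm_psum_le χ n).trans (by exact_mod_cast h.le)
    · obtain ⟨m, rfl⟩ := Nat.exists_eq_add_of_le' h
      rw [CN.psum_add χ hχ]
      exact ih m (by have := NeZero.pos q; omega)

noncomputable def CN.lterm (n : ℕ) (s : ℂ) : ℂ :=
  CN.psum χ (n + 1) * (((n + 1 : ℕ) : ℂ) ^ (-s) - ((n + 2 : ℕ) : ℂ) ^ (-s))

lemma CN.norm_lterm_le (n : ℕ) (s : ℂ) (hs : 0 < s.re) :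
    ‖CN.lterm χ n s‖ ≤ ‖CN.psum χ (n + 1)‖ * (‖s‖ * ((n + 1 : ℕ) : ℝ) ^ (-s.re - 1)) := by
  rw [CN.lterm, norm_mul]
  exact mul_le_mul_of_nonneg_left (CN.cpow_diff_bound n s hs) (norm_nonneg _)

lemma CN.summable_pow {r : ℝ} (hr : r < -1) : Summable fun n : ℕ => ((n + 1 : ℕ) : ℝ) ^ r :=
  (summable_nat_add_iff 1).mpr (Real.summable_nat_rpow.mpr hr)

lemma CN.summable_lterm (hχ : χ ≠ 1) (s : ℂ) (hs : 0 < s.re) :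
    Summable fun n => CN.lterm χ n s := by
  refine Summable.of_norm_bounded (g := fun n : ℕ => (q * ‖s‖) * ((n + 1 : ℕ) : ℝ) ^ (-s.re - 1))
    ((CN.summable_pow (by linarith)).mul_left _) fun n => ?_
  refine (CN.norm_lterm_le χ n s hs).trans ?_
  rw [← mul_assoc]
  gcongr
  exact CN.norm_psum_le' χ hχ _

lemma CN.LFunction_eq_of_one_lt (hχ : χ ≠ 1) (s : ℂ) (hs : 1 < s.re) :
    χ.LFunction s = ∑' n, CN.lterm χ n s := by
  rw [χ.LFunction_eq_LSeries hs, LSeries]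
  have hS := χ.LSeriesSummable_of_one_lt_re hs
  have h0 : (∑' n, LSeries.term (fun n => χ (n : ZMod q)) s n) =
      ∑' n, LSeries.term (fun n => χ (n : ZMod q)) s (n + 1) := by
    rw [hS.tsum_eq_zero_add]; simp
  rw [h0]
  have ht : ∀ n : ℕ, LSeries.term (fun n => χ (n : ZMod q)) s (n + 1) =
      CN.psum χ (n + 1) * ((n + 1 : ℕ) : ℂ) ^ (-s) - CN.psum χ n * ((n + 1 : ℕ) : ℂ) ^ (-s) := by
    intro n
    rw [LSeries.term_of_ne_zero (by omega), ← sub_mul, CN.psum, Finset.sum_range_succ, CN.psum,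
      add_sub_cancel_left, Complex.cpow_neg, div_eq_mul_inv]
  have hnorm : ∀ n : ℕ, ‖((n + 1 : ℕ) : ℂ) ^ (-s)‖ = ((n + 1 : ℕ) : ℝ) ^ (-s.re) := by
    intro n
    rw [Complex.norm_natCast_cpow_of_pos (by omega)]; simp
  have hs1 : Summable fun n : ℕ => CN.psum χ (n + 1) * ((n + 1 : ℕ) : ℂ) ^ (-s) := by
    refine Summable.of_norm_bounded (g := fun n : ℕ => q * ((n + 1 : ℕ) : ℝ) ^ (-s.re))
      ((CN.summable_pow (by linarith)).mul_left _) fun n => ?_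
    rw [norm_mul, hnorm]
    gcongr
    exact CN.norm_psum_le' χ hχ _
  have hs2 : Summable fun n : ℕ => CN.psum χ n * ((n + 1 : ℕ) : ℂ) ^ (-s) := by
    refine Summable.of_norm_bounded (g := fun n : ℕ => q * ((n + 1 : ℕ) : ℝ) ^ (-s.re))
      ((CN.summable_pow (by linarith)).mul_left _) fun n => ?_
    rw [norm_mul, hnorm]
    gcongr
    exact CN.norm_psum_le' χ hχ _
  simp_rw [ht]
  rw [hs1.tsum_sub hs2, hs2.tsum_eq_zero_add]
  have hs3 := (summable_nat_add_iff 1).mpr hs2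
  have hp0 : CN.psum χ 0 = 0 := by simp [CN.psum]
  simp only [hp0, zero_mul, zero_add]
  rw [← hs1.tsum_sub hs3]
  refine tsum_congr fun n => ?_
  rw [CN.lterm, mul_sub]

lemma CN.LFunction_eq (hχ : χ ≠ 1) (s : ℂ) (hs : 0 < s.re) :
    χ.LFunction s = ∑' n, CN.lterm χ n s := by
  set e := s.re / 2 with he
  set R := ‖s‖ + 3 with hR
  set U : Set ℂ := {z : ℂ | e < z.re} ∩ Metric.ball 0 R with hU
  have hUo : IsOpen U := (isOpen_lt continuous_const Complex.continuous_re).inter Metric.isOpen_ball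
  have hUc : IsPreconnected U :=
    ((convex_halfSpace_re_gt e).inter (convex_ball 0 R)).isPreconnected
  have hd : DifferentiableOn ℂ (fun w => ∑' n, CN.lterm χ n w) U := by
    refine Complex.differentiableOn_tsum_of_summable_norm
      (u := fun n : ℕ => (q * R) * ((n + 1 : ℕ) : ℝ) ^ (-e - 1))
      ((CN.summable_pow (by linarith)).mul_left _) ?_ hUo ?_
    · intro n
      refine Differentiable.differentiableOn ?_
      unfold CN.lterm
      refine (differentiable_const _).mul (Differentiable.sub ?_ ?_)
      · exact fun z => (differentiableAt_id.neg).const_cpow (Or.inl (Nat.cast_ne_zero.mpr (by omega)))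
      · exact fun z => (differentiableAt_id.neg).const_cpow (Or.inl (Nat.cast_ne_zero.mpr (by omega)))
    · intro n w hw
      have hw1 : e < w.re := hw.1
      have hw2 : ‖w‖ < R := by simpa using hw.2
      refine (CN.norm_lterm_le χ n w (by linarith)).trans ?_
      rw [← mul_assoc]
      have h1 := CN.norm_psum_le' χ hχ (n + 1)
      have h2 : ((n + 1 : ℕ) : ℝ) ^ (-w.re - 1) ≤ ((n + 1 : ℕ) : ℝ) ^ (-e - 1) :=
        Real.rpow_le_rpow_of_exponent_le (by push_cast; linarith [n.cast_nonneg (α := ℝ)])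
          (by linarith)
      gcongr
  have hLd : DifferentiableOn ℂ χ.LFunction U := (χ.differentiable_LFunction hχ).differentiableOn
  have h2U : ((2 + s.re : ℝ) : ℂ) ∈ U := by
    refine ⟨?_, ?_⟩
    · simp; linarith
    · have h1 : |2 + s.re| = 2 + s.re := abs_of_pos (by linarith)
      have h2 := Complex.re_le_norm s
      rw [Metric.mem_ball, dist_zero_right, Complex.norm_real, Real.norm_eq_abs, h1]
      linarith
  have hev : χ.LFunction =ᶠ[nhds ((2 + s.re : ℝ) : ℂ)] (fun w => ∑' n, CN.lterm χ n w) := by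
    have : IsOpen {z : ℂ | 1 < z.re} := isOpen_lt continuous_const Complex.continuous_re
    filter_upwards [this.mem_nhds (show ((2 + s.re : ℝ) : ℂ) ∈ {z : ℂ | 1 < z.re} by
      simp; linarith)] with z hz
    exact CN.LFunction_eq_of_one_lt χ hχ z hz
  have := (hLd.analyticOnNhd hUo).eqOn_of_preconnected_of_eventuallyEq (hd.analyticOnNhd hUo)
    hUc h2U hev
  exact this ⟨by simp [he]; linarith, by simp [hR]⟩

lemma CN.LFunction_im (hχ : χ ≠ 1) (hr : ∀ n : ℕ, (χ (n : ZMod q)).im = 0) (σ : ℝ) (hσ : 0 < σ) :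
    (χ.LFunction σ).im = 0 := by
  rw [CN.LFunction_eq χ hχ σ (by simpa using hσ), Complex.im_tsum (CN.summable_lterm χ hχ σ
    (by simpa using hσ))]
  refine (tsum_congr fun n => ?_).trans tsum_zero
  have h1 : (CN.psum χ (n + 1)).im = 0 := by
    rw [CN.psum, Complex.im_sum]
    exact Finset.sum_eq_zero fun k _ => hr _
  have h2 : ∀ m : ℕ, ((m : ℂ) ^ (-(σ : ℂ))) = (((m : ℝ) ^ (-σ) : ℝ) : ℂ) := by
    intro m
    rw [Complex.ofReal_cpow (by positivity)]; simp
  rw [CN.lterm, h2, h2, ← Complex.ofReal_sub, Complex.mul_im, h1]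
  simp

lemma CN.LFunction_bounds : ∃ K : ℝ, 1 ≤ K ∧ ∀ (q : ℕ) [NeZero q] (χ : DirichletCharacter ℂ q),
    χ ≠ 1 → (∀ s : ℂ, ‖s - 2‖ ≤ 3/2 → ‖χ.LFunction s‖ ≤ K * q) ∧
      ‖χ.LFunction 1‖ ≤ K * (q : ℝ) ^ (1/4 : ℝ) := by
  set K1 := ∑' n : ℕ, ((n + 1 : ℕ) : ℝ) ^ (-(3/2) : ℝ) with hK1
  set K2 := ∑' n : ℕ, ((n + 1 : ℕ) : ℝ) ^ (-(5/4) : ℝ) with hK2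
  have hK1n : 0 ≤ K1 := tsum_nonneg fun n => by positivity
  have hK2n : 0 ≤ K2 := tsum_nonneg fun n => by positivity
  refine ⟨1 + 4 * K1 + K2, by linarith, ?_⟩
  intro q _ χ hχ
  have hq0 : (0 : ℝ) ≤ q := by positivity
  constructor
  · intro s hs
    have hre : 1/2 ≤ s.re := by
      have := (abs_le.mp ((Complex.abs_re_le_norm _).trans hs)).1
      simp at this; linarith
    have hns : ‖s‖ ≤ 4 := by
      have := norm_add_le (s - 2) 2
      rw [sub_add_cancel] at this
      norm_num at this; linarith
    rw [CN.LFunction_eq χ hχ s (by linarith)]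
    have hle : ∀ n, ‖CN.lterm χ n s‖ ≤ (4 * q) * ((n + 1 : ℕ) : ℝ) ^ (-(3/2) : ℝ) := by
      intro n
      refine (CN.norm_lterm_le χ n s (by linarith)).trans ?_
      have h1 := CN.norm_psum_le' χ hχ (n + 1)
      have h2 : ((n + 1 : ℕ) : ℝ) ^ (-s.re - 1) ≤ ((n + 1 : ℕ) : ℝ) ^ (-(3/2) : ℝ) :=
        Real.rpow_le_rpow_of_exponent_le (by push_cast; linarith [n.cast_nonneg (α := ℝ)])
          (by linarith)
      calc _ ≤ q * (4 * ((n + 1 : ℕ) : ℝ) ^ (-(3/2) : ℝ)) := by gcongr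
        _ = _ := by ring
    have := tsum_of_norm_bounded ((CN.summable_pow (by norm_num : -(3/2) < (-1:ℝ))).mul_left
      (4 * (q : ℝ))).hasSum hle
    rw [tsum_mul_left, ← hK1] at this
    nlinarith [mul_nonneg hK2n hq0]
  · rw [CN.LFunction_eq χ hχ 1 (by simp)]
    have hle : ∀ n, ‖CN.lterm χ n 1‖ ≤ (q : ℝ) ^ (1/4 : ℝ) * ((n + 1 : ℕ) : ℝ) ^ (-(5/4) : ℝ) := by
      intro n
      refine (CN.norm_lterm_le χ n 1 (by simp)).trans ?_
      have h1 := CN.norm_psum_le' χ hχ (n + 1)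
      have h2 := CN.norm_psum_le χ (n + 1)
      have h3 : ‖CN.psum χ (n + 1)‖ ≤ (q : ℝ) ^ (1/4 : ℝ) * ((n + 1 : ℕ) : ℝ) ^ (3/4 : ℝ) := by
        calc ‖CN.psum χ (n + 1)‖ = ‖CN.psum χ (n + 1)‖ ^ (1/4 : ℝ) * ‖CN.psum χ (n + 1)‖ ^ (3/4 : ℝ) := by
              rw [← Real.rpow_add_of_nonneg (norm_nonneg _) (by norm_num) (by norm_num)]
              norm_num
          _ ≤ _ := by gcongr
      have hn : (0 : ℝ) < ((n + 1 : ℕ) : ℝ) := by positivity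
      simp only [norm_one, one_mul, Complex.one_re]
      calc _ ≤ (q : ℝ) ^ (1/4 : ℝ) * ((n + 1 : ℕ) : ℝ) ^ (3/4 : ℝ) *
              ((n + 1 : ℕ) : ℝ) ^ (-1 - 1 : ℝ) := by gcongr
        _ = _ := by
          rw [mul_assoc, ← Real.rpow_add hn]; norm_num
    have := tsum_of_norm_bounded ((CN.summable_pow (by norm_num : -(5/4) < (-1:ℝ))).mul_left
      ((q : ℝ) ^ (1/4 : ℝ))).hasSum hle
    rw [tsum_mul_left, ← hK2] at this
    have h5 : 0 ≤ (q : ℝ) ^ (1/4 : ℝ) := by positivity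
    nlinarith [mul_nonneg hK1n h5]

end
end

section
set_option linter.all false

open NumberTheorySymbols in
lemma CN.jac_mod (a : ℤ) (n : ℕ) (hn : Odd n) : J(a | n % (4 * a.natAbs)) = J(a | n) :=
  (jacobiSym.mod_right a hn).symm

instance CN.neZeroLevel (a : ℤ) [NeZero a] : NeZero (4 * a.natAbs) :=
  ⟨by have := Int.natAbs_ne_zero.mpr (NeZero.ne a); omega⟩

open NumberTheorySymbols in
noncomputable def CN.chi (a : ℤ) [NeZero a] : DirichletCharacter ℂ (4 * a.natAbs) where
  toFun x := if Odd x.val then ((J(a | x.val) : ℤ) : ℂ) else 0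
  map_one' := by
    have h : 1 < 4 * a.natAbs := by
      have := NeZero.ne (4 * a.natAbs); omega
    haveI : Fact (1 < 4 * a.natAbs) := ⟨h⟩
    simp [ZMod.val_one]
  map_mul' x y := by
    have h : Even (4 * a.natAbs) := Even.mul_right (by decide) _
    have hpar : Odd (x * y).val ↔ Odd (x.val * y.val) := by
      rw [ZMod.val_mul, Nat.odd_iff, Nat.odd_iff, Nat.mod_mod_of_dvd _ h.two_dvd]
    by_cases hx : Odd x.val
    · by_cases hy : Odd y.val
      · have hxy : Odd (x.val * y.val) := hx.mul hy
        rw [if_pos hx, if_pos hy, if_pos (hpar.mpr hxy), ZMod.val_mul, CN.jac_mod a _ hxy]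
        haveI : NeZero x.val := ⟨by rintro h; simp [h] at hx⟩
        haveI : NeZero y.val := ⟨by rintro h; simp [h] at hy⟩
        rw [jacobiSym.mul_right]
        push_cast; rfl
      · rw [if_neg hy, if_neg (by rw [hpar, Nat.odd_mul]; tauto), mul_zero]
    · rw [if_neg hx, if_neg (by rw [hpar, Nat.odd_mul]; tauto), zero_mul]
  map_nonunit' x hx := by
    split_ifs with ho
    · rw [← ZMod.natCast_zmod_val x, ZMod.isUnit_iff_coprime] at hx
      haveI : NeZero x.val := ⟨by rintro h; simp [h] at ho⟩
      have : J(a | x.val) = 0 := by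
        rw [jacobiSym.eq_zero_iff_not_coprime]
        intro hg
        apply hx
        refine Nat.Coprime.mul_right ?_ ?_
        · have : Nat.Coprime x.val 2 := (Nat.coprime_two_right).mpr ho
          exact Nat.Coprime.pow_right 2 this
        · rw [Nat.coprime_comm]
          rw [Int.gcd_eq_natAbs] at hg
          simpa only [Int.natAbs_natCast] using hg
      rw [this]; simp
    · rfl

open NumberTheorySymbols in
lemma CN.chi_apply (a : ℤ) [NeZero a] (n : ℕ) :
    CN.chi a (n : ZMod (4 * a.natAbs)) = if Odd n then ((J(a | n) : ℤ) : ℂ) else 0 := by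
  have h : Even (4 * a.natAbs) := Even.mul_right (by decide) _
  change (if Odd (n : ZMod (4 * a.natAbs)).val then
    ((J(a | (n : ZMod (4 * a.natAbs)).val) : ℤ) : ℂ) else 0) = _
  rw [ZMod.val_natCast]
  have hpar : Odd (n % (4 * a.natAbs)) ↔ Odd n := by
    rw [Nat.odd_iff, Nat.odd_iff, Nat.mod_mod_of_dvd _ h.two_dvd]
  by_cases hn : Odd n
  · rw [if_pos (hpar.mpr hn), if_pos hn, CN.jac_mod a n hn]
  · rw [if_neg (by rwa [hpar]), if_neg hn]

lemma CN.chi_cases (a : ℤ) [NeZero a] (n : ℕ) :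
    CN.chi a (n : ZMod (4 * a.natAbs)) = 0 ∨ CN.chi a (n : ZMod (4 * a.natAbs)) = 1 ∨
      CN.chi a (n : ZMod (4 * a.natAbs)) = -1 := by
  rw [CN.chi_apply]
  split_ifs
  · rcases jacobiSym.trichotomy a n with h | h | h <;> simp [h]
  · simp

lemma CN.chi_im (a : ℤ) [NeZero a] (n : ℕ) :
    (CN.chi a (n : ZMod (4 * a.natAbs))).im = 0 := by
  rcases CN.chi_cases a n with h | h | h <;> simp [h]

lemma CN.chi_sq (a : ℤ) [NeZero a] : CN.chi a ^ 2 = 1 := by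
  rw [← MulChar.isQuadratic_iff_sq_eq_one]
  intro x
  have := CN.chi_cases a x.val
  simpa using this

lemma CN.chi_mul (a b : ℤ) [NeZero a] [NeZero b] (n : ℕ) :
    CN.chi (a * b) (n : ZMod (4 * (a * b).natAbs)) =
      CN.chi a (n : ZMod (4 * a.natAbs)) * CN.chi b (n : ZMod (4 * b.natAbs)) := by
  rw [CN.chi_apply, CN.chi_apply, CN.chi_apply]
  split_ifs
  · rw [jacobiSym.mul_left]; push_cast; rfl
  · simp

open NumberTheorySymbols in
lemma CN.chi_ne_one_of (a : ℤ) [NeZero a] (n : ℕ) (hn : Odd n) (h : J(a | n) = -1) :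
    CN.chi a ≠ 1 := by
  intro h1
  have h2 := CN.chi_apply a n
  rw [if_pos hn, h, h1] at h2
  by_cases hu : IsUnit (n : ZMod (4 * a.natAbs))
  · rw [MulChar.one_apply hu] at h2; norm_num at h2
  · rw [MulChar.map_nonunit _ hu] at h2; norm_num at h2

open NumberTheorySymbols in
lemma CN.jac_one_of_modEq (a : ℤ) (ha : a ≠ 0) (n : ℕ) (hn : n % (4 * a.natAbs) = 1) :
    J(a | n) = 1 := by
  have ho : Odd n := by
    have h : 2 ∣ 4 * a.natAbs := ⟨2 * a.natAbs, by ring⟩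
    rw [Nat.odd_iff, ← Nat.mod_mod_of_dvd _ h, hn]
  rw [← CN.jac_mod a n ho, hn, jacobiSym.one_right]

open NumberTheorySymbols in
/-- If a prime `p` divides `a` exactly once, then the character of `a` is nontrivial. -/
lemma CN.chi_ne_one (p : ℕ) (hp : p.Prime) (b : ℤ) [NeZero ((p : ℤ) * b)] (hpb : ¬ (p : ℤ) ∣ b) :
    CN.chi (p * b) ≠ 1 := by
  have hb : b ≠ 0 := by rintro rfl; simp at hpb
  have hb' : 0 < b.natAbs := Int.natAbs_pos.mpr hb
  have hpb' : ¬ p ∣ b.natAbs := by rwa [← Int.natCast_dvd]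
  rcases hp.eq_two_or_odd' with rfl | hodd
  · -- n = 1 + 4 |b|
    have hbo : b.natAbs % 2 = 1 := by omega
    refine CN.chi_ne_one_of _ (1 + 4 * b.natAbs) (by rw [Nat.odd_iff]; omega) ?_
    rw [jacobiSym.mul_left, CN.jac_one_of_modEq b hb _ (by
      rw [Nat.add_mod_right, Nat.mod_eq_of_lt]; omega), mul_one]
    have := jacobiSym.at_two (b := 1 + 4 * b.natAbs) (by rw [Nat.odd_iff]; omega)
    rw [Nat.cast_two, this, ZMod.χ₈_nat_eq_if_mod_eight]
    rw [if_neg (by omega), if_neg (by omega)]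
  · haveI : Fact p.Prime := ⟨hp⟩
    obtain ⟨u, hu⟩ := FiniteField.exists_nonsquare (F := ZMod p) (by
      rw [ZMod.ringChar_zmod_n]; rintro rfl; exact absurd hodd (by decide))
    have hcop : Nat.Coprime (4 * b.natAbs) p := by
      refine Nat.Coprime.mul_left ?_ ?_
      · exact Nat.Coprime.pow_left 2 ((Nat.coprime_two_left).mpr hodd)
      · exact ((Nat.Prime.coprime_iff_not_dvd hp).mpr hpb').symm
    obtain ⟨n, hn1, hn2⟩ := Nat.chineseRemainder hcop 1 u.val
    have hn1' : n % (4 * b.natAbs) = 1 := by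
      have := hn1
      unfold Nat.ModEq at this
      rw [this, Nat.mod_eq_of_lt]; omega
    have hn4 : n % 4 = 1 := by
      rw [← Nat.mod_mod_of_dvd n (Dvd.intro _ rfl : 4 ∣ 4 * b.natAbs), hn1']
    refine CN.chi_ne_one_of _ n (by rw [Nat.odd_iff]; omega) ?_
    rw [jacobiSym.mul_left, CN.jac_one_of_modEq b hb _ hn1', mul_one,
      jacobiSym.quadratic_reciprocity_one_mod_four' hodd hn4]
    rw [← jacobiSym.legendreSym.to_jacobiSym, legendreSym.eq_neg_one_iff]
    have : ((n : ℤ) : ZMod p) = u := by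
      have h2 := (ZMod.natCast_eq_natCast_iff n u.val p).mpr hn2
      push_cast; rw [h2, ZMod.natCast_zmod_val]
    rwa [this]

lemma CN.chi_ne_one' (a : ℤ) [NeZero a] (p : ℕ) (hp : p.Prime) (h1 : (p : ℤ) ∣ a)
    (h2 : ¬ (p : ℤ) * p ∣ a) : CN.chi a ≠ 1 := by
  obtain ⟨b, rfl⟩ := h1
  exact CN.chi_ne_one p hp b (fun h => h2 (mul_dvd_mul_left _ h))

lemma CN.sqf_not_sq_dvd (d : ℤ) (hd : Squarefree d) (p : ℕ) (hp : p.Prime) :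
    ¬ (p : ℤ) * p ∣ d := by
  intro h
  have := hd _ h
  rw [Int.isUnit_iff_natAbs_eq] at this
  simp at this
  exact hp.one_lt.ne' this

lemma CN.chi_ne_one_sqf (d : ℤ) [NeZero d] (hd : Squarefree d) (h1 : d < -1) : CN.chi d ≠ 1 := by
  obtain ⟨p, hp, hpd⟩ := Nat.exists_prime_and_dvd (n := d.natAbs) (by omega)
  exact CN.chi_ne_one' d p hp (Int.natCast_dvd.mpr hpd) (CN.sqf_not_sq_dvd d hd p hp)

lemma CN.chi_mul_ne_one_sqf (d e : ℤ) [NeZero d] [NeZero e] (hd : Squarefree d)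
    (he : Squarefree e) (h1 : d < 0) (h2 : e < 0) (hne : d ≠ e) : CN.chi (d * e) ≠ 1 := by
  have key : ∃ p : ℕ, p.Prime ∧ ((p : ℤ) ∣ d ∧ ¬ (p : ℤ) ∣ e ∨ (p : ℤ) ∣ e ∧ ¬ (p : ℤ) ∣ d) := by
    by_contra hcon
    push Not at hcon
    have : d.natAbs = e.natAbs := by
      rw [← Nat.prod_primeFactors_of_squarefree (Int.squarefree_natAbs.mpr hd),
        ← Nat.prod_primeFactors_of_squarefree (Int.squarefree_natAbs.mpr he)]
      congr 1
      ext p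
      simp only [Nat.mem_primeFactors, ne_eq, Int.natAbs_eq_zero, NeZero.ne, not_false_eq_true,
        and_true]
      refine and_congr_right fun hp => ?_
      rw [← Int.natCast_dvd, ← Int.natCast_dvd]
      exact ⟨(hcon p hp).1, (hcon p hp).2⟩
    omega
  obtain ⟨p, hp, h | h⟩ := key
  · refine CN.chi_ne_one' _ p hp (h.1.mul_right _) fun hdvd => ?_
    have hpi : Prime (p : ℤ) := Nat.prime_iff_prime_int.mp hp
    obtain ⟨b, rfl⟩ := h.1
    rw [mul_assoc] at hdvd
    have h3 := Int.dvd_of_mul_dvd_mul_left hpi.ne_zero hdvd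
    rcases hpi.dvd_or_dvd h3 with h4 | h4
    · exact CN.sqf_not_sq_dvd _ hd p hp (mul_dvd_mul_left _ h4)
    · exact h.2 h4
  · refine CN.chi_ne_one' _ p hp (h.1.mul_left _) fun hdvd => ?_
    have hpi : Prime (p : ℤ) := Nat.prime_iff_prime_int.mp hp
    obtain ⟨b, rfl⟩ := h.1
    rw [mul_left_comm] at hdvd
    have h3 := Int.dvd_of_mul_dvd_mul_left hpi.ne_zero hdvd
    rcases hpi.dvd_or_dvd h3 with h4 | h4
    · exact h.2 h4
    · exact CN.sqf_not_sq_dvd _ he p hp (mul_dvd_mul_left _ h4)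
end

section
set_option linter.all false
open Complex ArithmeticFunction Topology Filter
open scoped ComplexOrder

lemma CN.mul_prime_pow (f g : ArithmeticFunction ℂ) (p : ℕ) (hp : p.Prime) (k : ℕ) :
    (f * g) (p ^ k) = ∑ i ∈ Finset.range (k + 1), f (p ^ i) * g (p ^ (k - i)) := by
  rw [ArithmeticFunction.mul_apply,
    Nat.sum_divisorsAntidiagonal (f := fun a b => f a * g b), Nat.sum_divisors_prime_pow hp]
  refine Finset.sum_congr rfl fun i hi => ?_
  rw [Nat.pow_div (by simpa [Nat.lt_succ_iff] using hi) hp.pos]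

lemma CN.f4_aux (u v w : ArithmeticFunction ℂ) (p : ℕ) (hp : p.Prime)
    (hu : ∀ k, u (p ^ k) = u p ^ k) (hv : ∀ k, v (p ^ k) = v p ^ k)
    (hw : ∀ k, w (p ^ k) = u p ^ k * v p ^ k)
    (hu' : u p = 0 ∨ u p = 1 ∨ u p = -1) (hv' : v p = 0 ∨ v p = 1 ∨ v p = -1)
    (hne : ¬ (u p = 1 ∧ v p = -1)) (k : ℕ) :
    0 ≤ ((((zeta : ArithmeticFunction ℕ) : ArithmeticFunction ℂ) * u) * (v * w)) (p ^ k) := by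
  have hA : ∀ i, (((zeta : ArithmeticFunction ℕ) : ArithmeticFunction ℂ) * u) (p ^ i)
      = ∑ l ∈ Finset.range (i + 1), u p ^ l := by
    intro i
    rw [coe_zeta_mul_apply, Nat.sum_divisors_prime_pow hp]
    exact Finset.sum_congr rfl fun l _ => hu l
  have hB : ∀ j, (v * w) (p ^ j) = v p ^ j * ∑ l ∈ Finset.range (j + 1), u p ^ l := by
    intro j
    rw [CN.mul_prime_pow _ _ p hp, Finset.mul_sum, ← Finset.sum_range_reflect]
    refine Finset.sum_congr rfl fun l hl => ?_
    have hl' : l ≤ j := by simpa [Nat.lt_succ_iff] using hl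
    rw [hv, hw]
    have e1 : j + 1 - 1 - l = j - l := by omega
    have e2 : j - (j - l) = l := by omega
    rw [e1, e2]
    have : v p ^ j = v p ^ (j - l) * v p ^ l := by rw [← pow_add]; congr 1; omega
    rw [this]; ring
  have hA0 : ∀ i, 0 ≤ ∑ l ∈ Finset.range (i + 1), u p ^ l := by
    intro i
    rcases hu' with h | h | h
    · exact Finset.sum_nonneg fun l _ => by rw [h]; exact pow_nonneg le_rfl _
    · exact Finset.sum_nonneg fun l _ => by rw [h]; exact pow_nonneg zero_le_one _
    · rw [h, neg_one_geom_sum]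
      split_ifs
      exacts [le_rfl, zero_le_one]
  rw [CN.mul_prime_pow _ _ p hp]
  simp only [hA, hB]
  rcases hv' with h | h | h
  · exact Finset.sum_nonneg fun l _ => mul_nonneg (hA0 _) (mul_nonneg (by rw [h]; exact pow_nonneg le_rfl _) (hA0 _))
  · exact Finset.sum_nonneg fun l _ => mul_nonneg (hA0 _) (mul_nonneg (by rw [h]; exact pow_nonneg zero_le_one _) (hA0 _))
  · rcases hu' with h' | h' | h'
    · have e : ∀ i, ∑ l ∈ Finset.range (i + 1), u p ^ l = 1 := by
        intro i; rw [h', Finset.sum_range_succ']; simp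
      simp only [e, one_mul, mul_one, h]
      rw [← Finset.sum_range_reflect]
      have : ∑ j ∈ Finset.range (k + 1), (-1 : ℂ) ^ (k - (k + 1 - 1 - j)) = ∑ j ∈ Finset.range (k + 1), (-1 : ℂ) ^ j := by
        refine Finset.sum_congr rfl fun l hl => ?_
        have hl' : l ≤ k := by simpa [Nat.lt_succ_iff] using hl
        congr 1; omega
      rw [this, neg_one_geom_sum]
      split_ifs
      exacts [le_rfl, zero_le_one]
    · exact absurd ⟨h', h⟩ hne
    · refine Finset.sum_nonneg fun l _ => mul_nonneg (hA0 _) ?_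
      rw [h', h, neg_one_geom_sum]
      split_ifs with hev
      · simp
      · have : Even (k - l) := by
          rw [Nat.even_add_one] at hev; simpa using hev
        rw [this.neg_one_pow]; simp

lemma CN.toAF_apply {q : ℕ} (χ : DirichletCharacter ℂ q) (n : ℕ) (hn : n ≠ 0) :
    toArithmeticFunction (χ ·) n = χ n := by
  simp [toArithmeticFunction, hn]

/-- the four fold convolution -/
noncomputable def CN.f4 {q1 q2 q3 : ℕ} (χ1 : DirichletCharacter ℂ q1) (χ2 : DirichletCharacter ℂ q2)
    (χ3 : DirichletCharacter ℂ q3) : ArithmeticFunction ℂ :=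
  χ1.zetaMul * (toArithmeticFunction (χ2 ·) * toArithmeticFunction (χ3 ·))

lemma CN.f4_mult {q1 q2 q3 : ℕ} (χ1 : DirichletCharacter ℂ q1) (χ2 : DirichletCharacter ℂ q2)
    (χ3 : DirichletCharacter ℂ q3) : (CN.f4 χ1 χ2 χ3).IsMultiplicative :=
  χ1.isMultiplicative_zetaMul.mul ((DirichletCharacter.isMultiplicative_toArithmeticFunction χ2).mul
    (DirichletCharacter.isMultiplicative_toArithmeticFunction χ3))

lemma CN.f4_nonneg {q1 q2 q3 : ℕ} (χ1 : DirichletCharacter ℂ q1) (χ2 : DirichletCharacter ℂ q2)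
    (χ3 : DirichletCharacter ℂ q3)
    (h1 : ∀ n : ℕ, χ1 n = 0 ∨ χ1 n = 1 ∨ χ1 n = -1)
    (h2 : ∀ n : ℕ, χ2 n = 0 ∨ χ2 n = 1 ∨ χ2 n = -1)
    (h3 : ∀ n : ℕ, χ3 n = χ1 n * χ2 n) (n : ℕ) : 0 ≤ CN.f4 χ1 χ2 χ3 n := by
  rcases eq_or_ne n 0 with rfl | hn
  · simp
  rw [(CN.f4_mult χ1 χ2 χ3).multiplicative_factorization _ hn]
  refine Finset.prod_nonneg fun p hp => ?_
  have hp := Nat.prime_of_mem_primeFactors hp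
  have ha : ∀ {q : ℕ} (χ : DirichletCharacter ℂ q) (k : ℕ), toArithmeticFunction (χ ·) (p ^ k)
      = χ p ^ k := by
    intro q χ k
    rw [CN.toAF_apply _ _ (pow_ne_zero _ hp.ne_zero)]; simp
  have hb : ∀ {q : ℕ} (χ : DirichletCharacter ℂ q), toArithmeticFunction (χ ·) p
      = χ p := fun χ => CN.toAF_apply _ _ hp.ne_zero
  by_cases hc : χ1 p = 1 ∧ χ2 p = -1
  · have e : CN.f4 χ1 χ2 χ3 = (((zeta : ArithmeticFunction ℕ) : ArithmeticFunction ℂ) *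
        toArithmeticFunction (χ2 ·)) * (toArithmeticFunction (χ1 ·) * toArithmeticFunction (χ3 ·)) := by
      unfold CN.f4 DirichletCharacter.zetaMul; ring
    rw [e]
    refine CN.f4_aux _ _ _ p hp ?_ ?_ ?_ ?_ ?_ ?_ _
    · intro k; rw [ha, hb]
    · intro k; rw [ha, hb]
    · intro k; rw [ha, hb, hb, h3, mul_pow, mul_comm]
    · rw [hb]; exact h2 p
    · rw [hb]; exact h1 p
    · rw [hb, hb, hc.1, hc.2]; norm_num
  · unfold CN.f4 DirichletCharacter.zetaMul
    refine CN.f4_aux _ _ _ p hp ?_ ?_ ?_ ?_ ?_ ?_ _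
    · intro k; rw [ha, hb]
    · intro k; rw [ha, hb]
    · intro k; rw [ha, hb, hb, h3, mul_pow]
    · rw [hb]; exact h1 p
    · rw [hb]; exact h2 p
    · rw [hb, hb]; exact hc

lemma CN.toAF_summable {q : ℕ} [NeZero q] (χ : DirichletCharacter ℂ q) {s : ℂ} (hs : 1 < s.re) :
    LSeriesSummable (toArithmeticFunction (χ ·)) s :=
  (LSeriesSummable_congr _ fun h ↦ (χ.apply_eq_toArithmeticFunction_apply h).symm).mpr <|
      ZMod.LSeriesSummable_of_one_lt_re χ hs

lemma CN.toAF_LSeries {q : ℕ} [NeZero q] (χ : DirichletCharacter ℂ q) {s : ℂ} (hs : 1 < s.re) :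
    LSeries (toArithmeticFunction (χ ·)) s = χ.LFunction s := by
  rw [χ.LFunction_eq_LSeries hs]
  exact (LSeries_congr χ.apply_eq_toArithmeticFunction_apply s).symm

lemma CN.zetaMul_LSeries {q : ℕ} [NeZero q] (χ : DirichletCharacter ℂ q) {s : ℂ} (hs : 1 < s.re) :
    LSeries χ.zetaMul s = riemannZeta s * χ.LFunction s := by
  rw [DirichletCharacter.zetaMul, ← coe_mul, LSeries_convolution']
  · rw [CN.toAF_LSeries χ hs]
    congr 1
    simp_rw [← LSeries_zeta_eq_riemannZeta hs, ← natCoe_apply]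
  · exact LSeriesSummable_zeta_iff.mpr hs
  · exact CN.toAF_summable χ hs

lemma CN.f4_summable {q1 q2 q3 : ℕ} [NeZero q1] [NeZero q2] [NeZero q3] (χ1 : DirichletCharacter ℂ q1) (χ2 : DirichletCharacter ℂ q2)
    (χ3 : DirichletCharacter ℂ q3) {s : ℂ} (hs : 1 < s.re) :
    LSeriesSummable (CN.f4 χ1 χ2 χ3) s :=
  ArithmeticFunction.LSeriesSummable_mul (χ1.LSeriesSummable_zetaMul hs)
    (ArithmeticFunction.LSeriesSummable_mul (CN.toAF_summable _ hs) (CN.toAF_summable _ hs))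

lemma CN.f4_LSeries {q1 q2 q3 : ℕ} [NeZero q1] [NeZero q2] [NeZero q3] (χ1 : DirichletCharacter ℂ q1) (χ2 : DirichletCharacter ℂ q2)
    (χ3 : DirichletCharacter ℂ q3) {s : ℂ} (hs : 1 < s.re) :
    LSeries (CN.f4 χ1 χ2 χ3) s = riemannZeta s * (χ1.LFunction s * χ2.LFunction s * χ3.LFunction s) := by
  rw [CN.f4, ArithmeticFunction.LSeries_mul' (χ1.LSeriesSummable_zetaMul hs)
    (ArithmeticFunction.LSeriesSummable_mul (CN.toAF_summable _ hs) (CN.toAF_summable _ hs)),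
    ArithmeticFunction.LSeries_mul' (CN.toAF_summable _ hs) (CN.toAF_summable _ hs),
    CN.toAF_LSeries _ hs, CN.toAF_LSeries _ hs, CN.zetaMul_LSeries _ hs]
  ring

/-- positivity at one -/
lemma CN.L_one_pos {q : ℕ} [NeZero q] (χ : DirichletCharacter ℂ q) (hχ : χ ≠ 1) (h2 : χ ^ 2 = 1)
    (hr : ∀ n : ℕ, (χ (n : ZMod q)).im = 0) :
    0 < (χ.LFunction 1).re := by
  have hcont : Continuous fun x : ℝ => (χ.LFunction (x : ℂ)).re :=
    Complex.continuous_re.comp ((DirichletCharacter.differentiable_LFunction hχ).continuous.comp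
      Complex.continuous_ofReal)
  have hpos : ∀ x : ℝ, 1 < x → 0 ≤ (χ.LFunction (x : ℂ)).re := by
    intro x hx
    have hx' : 1 < (x : ℂ).re := by simpa using hx
    have h1 := CN.zetaMul_LSeries χ hx'
    have hz := riemannZeta_pos_of_one_lt hx
    have h0 : 0 ≤ LSeries χ.zetaMul x := by
      refine tsum_nonneg fun n => ?_
      exact LSeries.term_nonneg (DirichletCharacter.zetaMul_nonneg h2 n) x
    rw [h1] at h0
    have hz2 := Complex.pos_iff.mp hz
    have h02 := (Complex.nonneg_iff.mp h0).1
    rw [Complex.mul_re, ← hz2.2, zero_mul, sub_zero] at h02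
    exact nonneg_of_mul_nonneg_right h02 hz2.1
  have h0 : 0 ≤ (χ.LFunction ((1 : ℝ) : ℂ)).re := by
    have ht : Tendsto (fun x : ℝ => (χ.LFunction (x : ℂ)).re) (𝓝[>] 1) (𝓝 (χ.LFunction ((1 : ℝ) : ℂ)).re) :=
      hcont.continuousAt.tendsto.mono_left nhdsWithin_le_nhds
    exact ge_of_tendsto ht (by filter_upwards [self_mem_nhdsWithin] with x hx using hpos x hx)
  have hne := DirichletCharacter.LFunction_apply_one_ne_zero hχ
  have him := CN.LFunction_im χ hχ hr 1 one_pos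
  simp only [Complex.ofReal_one] at h0 him
  refine lt_of_le_of_ne h0 fun h => hne ?_
  exact Complex.ext h.symm him
end

section
set_option linter.all false
open Complex Topology Filter

lemma CN.exists_N (X : ℝ) (hX : 1 ≤ X) : ∃ N : ℕ, 1 ≤ N ∧ X * (3/4) ^ N ≤ 1 ∧
    ∀ δ : ℝ, 0 ≤ δ → δ ≤ 1 → (1 + δ) ^ N ≤ 9 * X ^ (4 * δ) := by
  have hX0 : 0 < X := by linarith
  have hl : 0 ≤ Real.log X := Real.log_nonneg hX
  refine ⟨⌈4 * Real.log X⌉₊ + 1, by omega, ?_, ?_⟩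
  · have h1 : (3/4 : ℝ) ≤ Real.exp (-(1/4)) := by
      have := Real.add_one_le_exp (-(1/4) : ℝ); linarith
    have h2 : (3/4 : ℝ) ^ (⌈4 * Real.log X⌉₊ + 1) ≤ Real.exp (-Real.log X) := by
      calc (3/4 : ℝ) ^ (⌈4 * Real.log X⌉₊ + 1) ≤ Real.exp (-(1/4)) ^ (⌈4 * Real.log X⌉₊ + 1) :=
            pow_le_pow_left₀ (by norm_num) h1 _
        _ = Real.exp ((⌈4 * Real.log X⌉₊ + 1 : ℕ) * (-(1/4))) := (Real.exp_nat_mul _ _).symm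
        _ ≤ _ := by
            apply Real.exp_le_exp.mpr
            have := Nat.le_ceil (4 * Real.log X)
            push_cast; linarith
    calc X * (3/4 : ℝ) ^ (⌈4 * Real.log X⌉₊ + 1) ≤ X * Real.exp (-Real.log X) := by gcongr
      _ = 1 := by rw [Real.exp_neg, Real.exp_log hX0]; field_simp
  · intro δ h0 h1
    have h3 : (1 + δ) ≤ Real.exp δ := by have := Real.add_one_le_exp δ; linarith
    calc (1 + δ) ^ (⌈4 * Real.log X⌉₊ + 1) ≤ Real.exp δ ^ (⌈4 * Real.log X⌉₊ + 1) :=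
            pow_le_pow_left₀ (by linarith) h3 _
        _ = Real.exp ((⌈4 * Real.log X⌉₊ + 1 : ℕ) * δ) := (Real.exp_nat_mul _ _).symm
        _ ≤ Real.exp (2 + Real.log X * (4 * δ)) := by
            apply Real.exp_le_exp.mpr
            have := Nat.ceil_lt_add_one (show 0 ≤ 4 * Real.log X by linarith)
            push_cast
            nlinarith
        _ = Real.exp 1 ^ 2 * X ^ (4 * δ) := by
            rw [Real.exp_add, Real.rpow_def_of_pos hX0, ← Real.exp_nat_mul]; norm_num
        _ ≤ _ := by
            have : Real.exp 1 < 3 := by have := Real.exp_one_lt_d9; linarith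
            have h0 := Real.exp_pos 1
            gcongr
            nlinarith

lemma CN.zeta_neg : ∃ δ : ℝ, 0 < δ ∧ δ ≤ 1/64 ∧ (riemannZeta ((1 - δ : ℝ) : ℂ)).re < 0 ∧
    (riemannZeta ((1 - δ : ℝ) : ℂ)).im = 0 := by
  obtain ⟨P, hP, hP1, hPs⟩ := CN.exists_zeta_one
  have hc : Continuous fun x : ℝ => (P ((1 - x : ℝ) : ℂ)).re := by
    have := hP.continuous
    fun_prop
  have hev : ∀ᶠ x : ℝ in 𝓝 0, 0 < (P ((1 - x : ℝ) : ℂ)).re := by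
    have := hc.tendsto 0
    refine this.eventually (lt_mem_nhds ?_)
    simp [hP1]
  obtain ⟨ε, hε, hb⟩ := Metric.eventually_nhds_iff.mp hev
  refine ⟨min (ε/2) (1/64), by positivity, min_le_right _ _, ?_, ?_⟩
  all_goals set δ := min (ε/2) (1/64) with hδ
  all_goals have hδ0 : 0 < δ := by positivity
  · have h1 := hb (y := δ) (by
      rw [Real.dist_eq, sub_zero, abs_of_pos hδ0]
      have := min_le_left (ε/2) (1/64 : ℝ); linarith)
    rw [hPs _ (by intro h; have := congrArg Complex.re h; simp at this; linarith)] at h1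
    have e : (((1 - δ : ℝ) : ℂ) - 1) = ((-δ : ℝ) : ℂ) := by push_cast; ring
    rw [e, Complex.re_ofReal_mul] at h1
    nlinarith
  · have := riemannZeta_conj ((1 - δ : ℝ) : ℂ)
    rw [Complex.conj_ofReal] at this
    exact Complex.conj_eq_iff_im.mp this.symm
end

section
set_option linter.all false
open Complex Topology Filter
open scoped ComplexOrder

lemma CN.est_conv (C M g σ : ℝ) (hC : 1 ≤ C) (hM : 1 ≤ M) (h1 : 63/64 ≤ σ) (h2 : σ < 1)
    (h : ∀ N : ℕ, 1 ≤ N → 1 - g*(2-σ)^N/(1-σ) - C*M*(3/4)^N ≤ 0) :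
    (1 - σ) / 18 ≤ g * (2*C*M) ^ (1/16 : ℝ) := by
  have hX : 1 ≤ 2*C*M := by nlinarith
  obtain ⟨N, hN, hN1, hN2⟩ := CN.exists_N _ hX
  have h3 := h N hN
  have h4 := hN2 (1 - σ) (by linarith) (by linarith)
  have h5 : (2*C*M) ^ (4 * (1 - σ)) ≤ (2*C*M) ^ (1/16 : ℝ) :=
    Real.rpow_le_rpow_of_exponent_le hX (by linarith)
  have e : 1 + (1 - σ) = 2 - σ := by ring
  rw [e] at h4
  have hpos : 0 < (2 - σ)^N := pow_pos (by linarith) _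
  have hs : 0 < 1 - σ := by linarith
  have h6 : 1/2 ≤ g*(2-σ)^N/(1-σ) := by linarith
  rw [le_div_iff₀ hs] at h6
  have hg : 0 ≤ g := by
    by_contra hg
    nlinarith
  have h7 : g*(2-σ)^N ≤ g * (9 * (2*C*M) ^ (1/16 : ℝ)) := by gcongr; linarith
  linarith

lemma CN.siegel : ∃ c : ℝ, 0 < c ∧ ∃ N : ℤ, ∀ (d : ℤ) [NeZero d], d < N → Squarefree d →
    c ≤ ((CN.chi d).LFunction 1).re * (d.natAbs : ℝ) ^ (3/8 : ℝ) := by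
  obtain ⟨C, hC, hest⟩ := CN.estermann
  obtain ⟨K, hK, hL⟩ := CN.LFunction_bounds
  obtain ⟨δ, hδ0, hδ1, hz, hzi⟩ := CN.zeta_neg
  by_cases hcase : ∀ (d : ℤ) [NeZero d], d < -1 → Squarefree d →
      0 ≤ ((CN.chi d).LFunction ((1 - δ : ℝ) : ℂ)).re
  · have hA : 0 < (2*C*(K*4)) ^ (1/16 : ℝ) := by positivity
    refine ⟨δ / 18 / (2*C*(K*4)) ^ (1/16 : ℝ), by positivity, -1, ?_⟩
    intro d _ hd hsq
    have hne := CN.chi_ne_one_sqf d hsq hd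
    have hD : 1 ≤ (d.natAbs : ℝ) := by exact_mod_cast (by omega : 1 ≤ d.natAbs)
    obtain ⟨hb, -⟩ := hL _ (CN.chi d) hne
    have hpos := CN.L_one_pos (CN.chi d) hne (CN.chi_sq d) (CN.chi_im d)
    have key := CN.est_conv C (K * ((4 * d.natAbs : ℕ) : ℝ)) ((CN.chi d).LFunction 1).re (1 - δ) hC
      (by push_cast; nlinarith) (by linarith) (by linarith) (by
        intro N hN
        have h1 := hest (CN.chi d).LFunction (K * ((4 * d.natAbs : ℕ) : ℝ)) (CN.chi d).zetaMul
          (DirichletCharacter.differentiable_LFunction hne) hb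
          (DirichletCharacter.zetaMul_nonneg (CN.chi_sq d))
          (by rw [(CN.chi d).isMultiplicative_zetaMul.map_one])
          (fun s hs => DirichletCharacter.LSeriesSummable_zetaMul _ hs)
          (fun s hs => CN.zetaMul_LSeries _ hs) N hN (1 - δ) (by linarith) (by linarith)
        refine h1.trans ?_
        rw [Complex.mul_re, hzi, zero_mul, sub_zero]
        exact mul_nonpos_of_nonpos_of_nonneg hz.le (hcase d hd hsq))
    rw [div_le_iff₀ hA]
    have e : 2*C*(K * ((4 * d.natAbs : ℕ) : ℝ)) = (2*C*(K*4)) * (d.natAbs : ℝ) := by push_cast; ring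
    rw [e, Real.mul_rpow (by positivity) (by positivity)] at key
    have h2 : (d.natAbs : ℝ) ^ (1/16 : ℝ) ≤ (d.natAbs : ℝ) ^ (3/8 : ℝ) :=
      Real.rpow_le_rpow_of_exponent_le hD (by norm_num)
    have e2 : 1 - (1 - δ) = δ := by ring
    rw [e2] at key
    refine key.trans ?_
    calc _ ≤ ((CN.chi d).LFunction 1).re * ((2*C*(K*4)) ^ (1/16 : ℝ) * (d.natAbs : ℝ) ^ (3/8 : ℝ)) := by gcongr
      _ = _ := by ring
  · push Not at hcase
    obtain ⟨d1, _, hd1, hsq1, hneg⟩ := hcase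
    have hne1 := CN.chi_ne_one_sqf d1 hsq1 hd1
    have hpos1 := CN.L_one_pos (CN.chi d1) hne1 (CN.chi_sq d1) (CN.chi_im d1)
    have hcont : Continuous fun x : ℝ => ((CN.chi d1).LFunction (x : ℂ)).re :=
      Complex.continuous_re.comp ((DirichletCharacter.differentiable_LFunction hne1).continuous.comp
        Complex.continuous_ofReal)
    have hivt := intermediate_value_Ioo (show (1 - δ) ≤ 1 by linarith) hcont.continuousOn
    obtain ⟨β, hβ, hβ0⟩ := hivt (show (0 : ℝ) ∈ _ from ⟨hneg, by simpa using hpos1⟩)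
    have hβ0' : (CN.chi d1).LFunction (β : ℂ) = 0 :=
      Complex.ext hβ0 (CN.LFunction_im _ hne1 (CN.chi_im d1) β (by linarith [hβ.1]))
    set L1 := ((CN.chi d1).LFunction 1).re with hL1
    set D1 := (d1.natAbs : ℝ) with hD1d
    have hD1 : 1 ≤ D1 := by rw [hD1d]; exact_mod_cast (by omega : 1 ≤ d1.natAbs)
    set A := 2*C*(K^3*64*D1^2) with hA
    have hA0 : 0 < A ^ (1/16 : ℝ) := by positivity
    have hW : 0 < L1 * (K * (4*D1) ^ (1/4 : ℝ)) * A ^ (1/16 : ℝ) := by positivity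
    refine ⟨(1 - β) / 18 / (L1 * (K * (4*D1) ^ (1/4 : ℝ)) * A ^ (1/16 : ℝ)),
      div_pos (by linarith [hβ.2]) hW, d1, ?_⟩
    intro d _ hd hsq
    have hne := CN.chi_ne_one_sqf d hsq (by omega)
    have hne3 := CN.chi_mul_ne_one_sqf d1 d hsq1 hsq (by omega) (by omega) (by omega)
    set D := (d.natAbs : ℝ) with hDd
    have hD : 1 ≤ D := by rw [hDd]; exact_mod_cast (by omega : 1 ≤ d.natAbs)
    have hpos := CN.L_one_pos (CN.chi d) hne (CN.chi_sq d) (CN.chi_im d)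
    have hpos3 := CN.L_one_pos (CN.chi (d1*d)) hne3 (CN.chi_sq _) (CN.chi_im _)
    obtain ⟨hb1, -⟩ := hL _ (CN.chi d1) hne1
    obtain ⟨hb2, -⟩ := hL _ (CN.chi d) hne
    obtain ⟨hb3, hb3'⟩ := hL _ (CN.chi (d1*d)) hne3
    have hre : ∀ (a : ℤ) [NeZero a], CN.chi a ≠ 1 → (CN.chi a).LFunction 1 = (((CN.chi a).LFunction 1).re : ℂ) := by
      intro a _ ha
      refine Complex.ext (by simp) ?_
      have := CN.LFunction_im _ ha (CN.chi_im a) 1 one_pos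
      simpa using this
    have hcast : ((4 * (d1*d).natAbs : ℕ) : ℝ) = 4 * D1 * D := by
      rw [Int.natAbs_mul]; push_cast; ring
    have hcast1 : ((4 * d1.natAbs : ℕ) : ℝ) = 4 * D1 := by push_cast; ring
    have hcast2 : ((4 * d.natAbs : ℕ) : ℝ) = 4 * D := by push_cast; ring
    rw [hcast] at hb3 hb3'
    rw [hcast1] at hb1
    rw [hcast2] at hb2
    have key := CN.est_conv C (K^3*64*D1^2*D^2) (L1 * ((CN.chi d).LFunction 1).re *
        ((CN.chi (d1*d)).LFunction 1).re) β hC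
      (by
        have : 1 ≤ K^3 := one_le_pow₀ hK
        have : 1 ≤ D1^2 := one_le_pow₀ hD1
        have : 1 ≤ D^2 := one_le_pow₀ hD
        have : 1 ≤ K^3 * 64 := by linarith
        have : 1 ≤ K^3 * 64 * D1^2 := one_le_mul_of_one_le_of_one_le this (by assumption)
        exact one_le_mul_of_one_le_of_one_le this (by assumption)) (by linarith [hβ.1]) hβ.2 (by
        intro N hN
        have h1 := hest (fun s => (CN.chi d1).LFunction s * (CN.chi d).LFunction s * (CN.chi (d1*d)).LFunction s)
          (K^3*64*D1^2*D^2) (CN.f4 (CN.chi d1) (CN.chi d) (CN.chi (d1*d)))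
          (((DirichletCharacter.differentiable_LFunction hne1).mul
            (DirichletCharacter.differentiable_LFunction hne)).mul
            (DirichletCharacter.differentiable_LFunction hne3))
          (by
            intro s hs
            simp only [norm_mul]
            calc _ ≤ (K * (4*D1)) * (K * (4*D)) * (K * (4*D1*D)) := by
                  gcongr
                  · exact hb1 s hs
                  · exact hb2 s hs
                  · exact hb3 s hs
              _ = _ := by ring)
          (CN.f4_nonneg _ _ _ (CN.chi_cases d1) (CN.chi_cases d) (fun n => CN.chi_mul d1 d n))
          (by rw [(CN.f4_mult _ _ _).map_one])
          (fun s hs => CN.f4_summable _ _ _ hs)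
          (fun s hs => CN.f4_LSeries _ _ _ hs) N hN β (by linarith [hβ.1]) hβ.2
        simp only [hβ0', zero_mul, mul_zero, Complex.zero_re] at h1
        rw [hre d1 hne1, hre d hne, hre _ hne3, ← Complex.ofReal_mul, ← Complex.ofReal_mul,
          Complex.ofReal_re] at h1
        exact h1)
    have hL3 : ((CN.chi (d1*d)).LFunction 1).re ≤ K * ((4*D1) ^ (1/4 : ℝ) * D ^ (1/4 : ℝ)) := by
      rw [← Real.mul_rpow (by positivity) (by positivity)]
      exact (Complex.re_le_norm _).trans hb3'
    have e : 2*C*(K^3*64*D1^2*D^2) = A * D^2 := by rw [hA]; ring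
    have e3 : (D^2) ^ (1/16 : ℝ) = D ^ (1/8 : ℝ) := by
      rw [← Real.rpow_natCast, ← Real.rpow_mul (by positivity)]; norm_num
    have e4 : D ^ (3/8 : ℝ) = D ^ (1/4 : ℝ) * D ^ (1/8 : ℝ) := by
      rw [← Real.rpow_add (by linarith)]; norm_num
    rw [e, Real.mul_rpow (by positivity) (by positivity), e3] at key
    rw [div_le_iff₀ hW, e4]
    refine key.trans ?_
    calc _ ≤ L1 * ((CN.chi d).LFunction 1).re * (K * ((4*D1) ^ (1/4 : ℝ) * D ^ (1/4 : ℝ))) * (A ^ (1/16 : ℝ) * D ^ (1/8 : ℝ)) := by gcongr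
      _ = _ := by ring
end

section
set_option linter.all false
open NumberField Polynomial

lemma CN.trace_alpha (K : Type) [Field K] [NumberField K] (d : ℤ) (hd : d < 0) (a : 𝓞 K)
    (ha : a ^ 2 = (d : 𝓞 K)) : Algebra.trace ℤ (𝓞 K) a = 0 := by
  have h := Algebra.coe_trace_int a
  have hα : (a : K) ^ 2 = (d : K) := by
    have := congrArg (algebraMap (𝓞 K) K) ha
    simpa using this
  have hmon : (X ^ 2 - C (d : ℚ) : ℚ[X]).Monic := monic_X_pow_sub_C _ two_ne_zero
  have hirr : Irreducible (X ^ 2 - C (d : ℚ) : ℚ[X]) := by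
    refine (Polynomial.irreducible_iff_roots_eq_zero_of_degree_le_three (by rw [natDegree_X_pow_sub_C])
      (by rw [natDegree_X_pow_sub_C]; norm_num)).mpr ?_
    rw [Multiset.eq_zero_iff_forall_notMem]
    intro x hx
    have := (Polynomial.mem_roots'.mp hx).2
    simp only [IsRoot.def, eval_sub, eval_pow, eval_X, eval_C] at this
    have hd' : (d : ℚ) < 0 := by exact_mod_cast hd
    nlinarith [sq_nonneg x]
  have hmin : X ^ 2 - C (d : ℚ) = minpoly ℚ (a : K) :=
    minpoly.eq_of_irreducible_of_monic hirr (by simp [hα]) hmon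
  rw [trace_eq_finrank_mul_minpoly_nextCoeff, ← hmin, nextCoeff_of_natDegree_pos
    (by rw [natDegree_X_pow_sub_C]; norm_num), natDegree_X_pow_sub_C] at h
  rw [coeff_sub, coeff_X_pow, coeff_C] at h
  norm_num at h
  exact h

lemma CN.discr_ge (K : Type) [Field K] [NumberField K] (hK : Module.finrank ℚ K = 2)
    (d : ℤ) (hd : d < 0) (hsq : Squarefree d) (a : 𝓞 K)
    (ha : a ^ 2 = (d : 𝓞 K)) : d.natAbs ≤ (NumberField.discr K).natAbs := by
  have hcard : Fintype.card (Module.Free.ChooseBasisIndex ℤ (𝓞 K)) = 2 := by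
    rw [← Module.finrank_eq_card_chooseBasisIndex, RingOfIntegers.rank, hK]
  let e : Module.Free.ChooseBasisIndex ℤ (𝓞 K) ≃ Fin 2 := Fintype.equivFinOfCardEq hcard
  let b := (RingOfIntegers.basis K).reindex e
  have hb : Algebra.discr ℤ b = NumberField.discr K := by
    rw [NumberField.discr, ← Algebra.discr_reindex ℤ (RingOfIntegers.basis K) e]
    congr 1
    ext i
    simp [b]
  have hrank : Module.finrank ℤ (𝓞 K) = 2 := by rw [RingOfIntegers.rank, hK]
  let v : Fin 2 → 𝓞 K := ![1, a]
  have hv : Algebra.discr ℤ v = 4 * d := by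
    rw [Algebra.discr_def, Matrix.det_fin_two]
    have ht := CN.trace_alpha K d hd a ha
    have h1 : Algebra.trace ℤ (𝓞 K) 1 = 2 := by
      have := Algebra.trace_algebraMap (R := ℤ) (S := 𝓞 K) 1
      rw [hrank] at this
      simpa using this
    have h2 : Algebra.trace ℤ (𝓞 K) (a * a) = 2 * d := by
      have := Algebra.trace_algebraMap (R := ℤ) (S := 𝓞 K) d
      rw [hrank] at this
      rw [← pow_two, ha]
      simpa using this
    simp [Algebra.traceMatrix_apply, Algebra.traceForm_apply, v, ht, h1, h2]
    ring
  have hP : v = Matrix.vecMul b ((b.toMatrix v).map (algebraMap ℤ (𝓞 K))) := by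
    funext i
    have := b.sum_toMatrix_smul_self v i
    rw [← this]
    simp [Matrix.vecMul, dotProduct, Algebra.smul_def, mul_comm]
  have key : 4 * d = (b.toMatrix v).det ^ 2 * NumberField.discr K := by
    rw [← hb, ← hv]
    conv_lhs => rw [hP]
    exact Algebra.discr_of_matrix_vecMul _ _
  set k := (b.toMatrix v).det
  set D := NumberField.discr K
  have hk : k ^ 2 ≤ 4 := by
    rcases Int.even_or_odd k with ⟨m, hm⟩ | hodd
    · have h1 : d = m * m * D := by rw [hm] at key; nlinarith
      have := Int.isUnit_iff.mp (hsq m ⟨D, h1⟩)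
      rcases this with h | h <;> rw [hm, h] <;> norm_num
    · have hcop : IsCoprime (k * k) (4 : ℤ) := by
        have : IsCoprime k (2 : ℤ) := by
          obtain ⟨m, hm⟩ := hodd
          exact ⟨1, -m, by rw [hm]; ring⟩
        have h2 : IsCoprime k (4 : ℤ) := by
          have := this.pow_right (n := 2); norm_num at this; exact this
        exact h2.mul_left h2
      have h1 : k * k ∣ d := hcop.dvd_of_dvd_mul_left ⟨D, by rw [key]; ring⟩
      have := Int.isUnit_iff.mp (hsq k h1)
      rcases this with h | h <;> rw [h] <;> norm_num
  have h3 : 4 * |d| = k ^ 2 * |D| := by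
    have := congrArg abs key
    rw [abs_mul, abs_mul, abs_pow, sq_abs] at this
    simpa using this
  have h4 : |d| ≤ |D| := by nlinarith [abs_nonneg D]
  rw [Int.abs_eq_natAbs, Int.abs_eq_natAbs] at h4
  exact_mod_cast h4

lemma CN.tot_complex (K : Type) [Field K] [NumberField K] 
    (d : ℤ) (hd : d < 0) (a : 𝓞 K)
    (ha : a ^ 2 = (d : 𝓞 K)) : IsTotallyComplex K := by
  refine ⟨fun v => ?_⟩
  rw [← InfinitePlace.not_isReal_iff_isComplex]
  rintro ⟨φ, hφ, rfl⟩
  have hα : (a : K) ^ 2 = (d : K) := by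
    have := congrArg (algebraMap (𝓞 K) K) ha
    simpa using this
  have h1 := congrArg φ hα
  rw [map_pow, map_intCast] at h1
  have h2 : (φ (a : K)).im = 0 := by
    have := congrArg (fun f => f (a : K)) hφ
    simp only [ComplexEmbedding.conjugate_coe_eq] at this
    exact Complex.conj_eq_iff_im.mp this
  have h3 := congrArg Complex.re h1
  simp [pow_two, Complex.mul_re, h2] at h3
  have : (d : ℝ) < 0 := by exact_mod_cast hd
  nlinarith [mul_self_nonneg (φ (a : K)).re]

lemma CN.residue_le (K : Type) [Field K] [NumberField K] (hK : Module.finrank ℚ K = 2)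
    (d : ℤ) (hd : d < 0) (hsq : Squarefree d) (a : 𝓞 K)
    (ha : a ^ 2 = (d : 𝓞 K)) :
    dedekindZeta_residue K * Real.sqrt (d.natAbs : ℝ) ≤ 2 * Real.pi * classNumber K := by
  have := CN.tot_complex K d hd a ha
  have hc : InfinitePlace.nrComplexPlaces K = 1 := by
    have := IsTotallyComplex.finrank (K := K); omega
  have hcard : Fintype.card (InfinitePlace K) = 1 := by
    rw [InfinitePlace.card_eq_nrRealPlaces_add_nrComplexPlaces, hc,
      IsTotallyComplex.nrRealPlaces_eq_zero]
  have hreg : Units.regulator K = 1 := by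
    classical
    have hsub : Subsingleton (InfinitePlace K) := by
      rw [← Fintype.card_le_one_iff_subsingleton, hcard]
    have : IsEmpty {w : InfinitePlace K // w ≠ Units.dirichletUnitTheorem.w₀} :=
      ⟨fun w => w.2 (Subsingleton.elim _ _)⟩
    rw [Units.regulator_eq_det']
    have hdet : ∀ {n : Type} [IsEmpty n] (i1 : DecidableEq n) (i2 : Fintype n) (M : Matrix n n ℝ),
        |M.det| = 1 := by
      intro n _ i1 i2 M
      rw [Matrix.det_isEmpty]; simp
    exact hdet _ _ _
  rw [dedekindZeta_residue_def, hc, hreg, IsTotallyComplex.nrRealPlaces_eq_zero]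
  have hD := CN.discr_ge K hK d hd hsq a ha
  have ht : 1 ≤ (Units.torsionOrder K : ℝ) := by exact_mod_cast Units.torsionOrder_pos K
  have hD' : (d.natAbs : ℝ) ≤ |(NumberField.discr K : ℝ)| := by
    rw [← Int.cast_abs, Int.abs_eq_natAbs, Int.cast_natCast]; exact Nat.cast_le.mpr hD
  have hs := Real.sqrt_le_sqrt hD'
  have hpos : 0 < Real.sqrt |(NumberField.discr K : ℝ)| :=
    Real.sqrt_pos_of_pos <| abs_pos.mpr (Int.cast_ne_zero.mpr (discr_ne_zero K))
  rw [div_mul_eq_mul_div, div_le_iff₀ (by positivity)]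
  simp only [pow_zero, one_mul, pow_one, mul_one]
  have : Real.sqrt (d.natAbs : ℝ) ≤ (Units.torsionOrder K : ℝ) * Real.sqrt |(NumberField.discr K : ℝ)| := by
    nlinarith
  have hpi := Real.pi_pos
  gcongr
end

section
set_option linter.all false
open NumberField

/-- number of ideals of given norm -/
noncomputable def CN.ic (K : Type) [Field K] [NumberField K] (m : ℕ) : ℕ :=
  Nat.card {I : Ideal (𝓞 K) // Ideal.absNorm I = m}

lemma CN.ic_finite (K : Type) [Field K] [NumberField K] (m : ℕ) :
    Finite {I : Ideal (𝓞 K) // Ideal.absNorm I = m} :=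
  (Ideal.finite_setOfPred_absNorm_eq (S := 𝓞 K) m).to_subtype

lemma CN.coprime_of_norm {K : Type} [Field K] [NumberField K] (I J : Ideal (𝓞 K))
    (h : Nat.Coprime (Ideal.absNorm I) (Ideal.absNorm J)) : IsCoprime I J := by
  rw [Ideal.isCoprime_iff_exists]
  obtain ⟨u, v, huv⟩ := Nat.isCoprime_iff_coprime.mpr h
  refine ⟨(u : 𝓞 K) * (Ideal.absNorm I : 𝓞 K), Ideal.mul_mem_left _ _ (Ideal.absNorm_mem I),
    (v : 𝓞 K) * (Ideal.absNorm J : 𝓞 K), Ideal.mul_mem_left _ _ (Ideal.absNorm_mem J), ?_⟩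
  exact_mod_cast congrArg (Int.cast : ℤ → 𝓞 K) huv

lemma CN.ic_mul (K : Type) [Field K] [NumberField K] (m n : ℕ) (h : Nat.Coprime m n) :
    CN.ic K m * CN.ic K n ≤ CN.ic K (m * n) := by
  have := CN.ic_finite K (m * n)
  unfold CN.ic
  rw [← Nat.card_prod]
  refine Nat.card_le_card_of_injective
    (fun x => ⟨x.1.1 * x.2.1, by rw [map_mul, x.1.2, x.2.2]⟩) ?_
  rintro ⟨⟨I, hI⟩, ⟨J, hJ⟩⟩ ⟨⟨I', hI'⟩, ⟨J', hJ'⟩⟩ hx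
  have hx : I * J = I' * J' := congrArg Subtype.val hx
  have c1 : IsCoprime I J' := CN.coprime_of_norm _ _ (by rw [hI, hJ']; exact h)
  have c2 : IsCoprime I' J := CN.coprime_of_norm _ _ (by rw [hI', hJ]; exact h)
  have e1 : I = I' := by
    apply dvd_antisymm
    · exact c1.dvd_of_dvd_mul_right (hx ▸ dvd_mul_right I J)
    · exact c2.dvd_of_dvd_mul_right (hx ▸ dvd_mul_right I' J')
  have e2 : J = J' := by
    apply dvd_antisymm
    · exact c2.symm.dvd_of_dvd_mul_left (hx ▸ dvd_mul_left J I)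
    · exact c1.symm.dvd_of_dvd_mul_left (hx ▸ dvd_mul_left J' I')
  subst e1 e2; rfl

lemma CN.ic_pos {K : Type} [Field K] [NumberField K] (I : Ideal (𝓞 K)) :
    1 ≤ CN.ic K (Ideal.absNorm I) := by
  have := CN.ic_finite K (Ideal.absNorm I)
  have : Nonempty {J : Ideal (𝓞 K) // Ideal.absNorm J = Ideal.absNorm I} := ⟨⟨I, rfl⟩⟩
  exact Nat.card_pos

lemma CN.norm_nat (K : Type) [Field K] [NumberField K] (hK : Module.finrank ℚ K = 2) (n : ℕ) :
    Ideal.absNorm (Ideal.span {(n : 𝓞 K)}) = n ^ 2 := by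
  rw [Ideal.absNorm_span_natCast, RingOfIntegers.rank, hK]

lemma CN.ic_inert (K : Type) [Field K] [NumberField K] (hK : Module.finrank ℚ K = 2) (p k : ℕ)
    (hk : Even k) : 1 ≤ CN.ic K (p ^ k) := by
  obtain ⟨m, rfl⟩ := hk
  have := CN.ic_pos (Ideal.span {((p ^ m : ℕ) : 𝓞 K)})
  rw [CN.norm_nat K hK] at this
  convert this using 2; ring

lemma CN.ic_ram (K : Type) [Field K] [NumberField K] (hK : Module.finrank ℚ K = 2) (d : ℤ)
    (hsq : Squarefree d) (a : 𝓞 K) (ha : a ^ 2 = (d : 𝓞 K)) (p k : ℕ) (hp : p.Prime)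
    (hpd : (p : ℤ) ∣ d) : 1 ≤ CN.ic K (p ^ k) := by
  obtain ⟨e, he⟩ := hpd
  have hcop : IsCoprime (p : ℤ) e := by
    have hpp : Prime (p : ℤ) := Nat.prime_iff_prime_int.mp hp
    refine (Prime.coprime_iff_not_dvd hpp).mpr ?_
    rintro ⟨f, rfl⟩
    exact hpp.not_unit (hsq p ⟨f, by rw [he]; ring⟩)
  obtain ⟨u, v, huv⟩ := hcop
  set P : Ideal (𝓞 K) := Ideal.span {(p : 𝓞 K), a} with hP
  have hpP : (p : 𝓞 K) ∈ P := Ideal.subset_span (by simp)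
  have haP : a ∈ P := Ideal.subset_span (by simp)
  have hde : (d : 𝓞 K) = p * e := by rw [he]; push_cast; ring
  have huv' : (u : 𝓞 K) * p + v * e = 1 := by exact_mod_cast congrArg (Int.cast : ℤ → 𝓞 K) huv
  have hPP : P * P = Ideal.span {(p : 𝓞 K)} := by
    apply le_antisymm
    · rw [hP, Ideal.span_pair_mul_span_pair, Ideal.span_le]
      rintro x (rfl | rfl | rfl | rfl)
      all_goals rw [SetLike.mem_coe, Ideal.mem_span_singleton]
      · exact dvd_mul_right _ _
      · exact dvd_mul_right _ _
      · exact dvd_mul_left _ _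
      · rw [← pow_two, ha, hde]; exact dvd_mul_right _ _
    · rw [Ideal.span_singleton_le_iff_mem]
      have : (p : 𝓞 K) = u * (p * p) + v * (a * a) := by
        rw [← pow_two a, ha, hde]
        linear_combination (-(p : 𝓞 K)) * huv'
      rw [this]
      exact Ideal.add_mem _ (Ideal.mul_mem_left _ _ (Ideal.mul_mem_mul hpP hpP))
        (Ideal.mul_mem_left _ _ (Ideal.mul_mem_mul haP haP))
  have hN : Ideal.absNorm P = p := by
    have := congrArg Ideal.absNorm hPP
    rw [map_mul, CN.norm_nat K hK, ← pow_two] at this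
    exact Nat.pow_left_injective two_ne_zero this
  have := CN.ic_pos (P ^ k)
  rwa [map_pow, hN] at this

lemma CN.ic_split (K : Type) [Field K] [NumberField K] (hK : Module.finrank ℚ K = 2) (d : ℤ)
    (hd : d < 0) (a : 𝓞 K) (ha : a ^ 2 = (d : 𝓞 K)) (p k : ℕ) (hp : p.Prime) (r : ℤ)
    (hr : (p : ℤ) ∣ d - r ^ 2) (hr0 : ¬ (p : ℤ) ∣ 2 * r) : k + 1 ≤ CN.ic K (p ^ k) := by
  obtain ⟨e, he⟩ := hr
  have hpp : Prime (p : ℤ) := Nat.prime_iff_prime_int.mp hp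
  have hcop : IsCoprime (p : ℤ) (2 * r) := (Prime.coprime_iff_not_dvd hpp).mpr hr0
  obtain ⟨u, v, huv⟩ := hcop
  set P : Ideal (𝓞 K) := Ideal.span {(p : 𝓞 K), a - r} with hP
  set Q : Ideal (𝓞 K) := Ideal.span {(p : 𝓞 K), a + r} with hQ
  have hpP : (p : 𝓞 K) ∈ P := Ideal.subset_span (by simp)
  have haP : a - r ∈ P := Ideal.subset_span (by simp)
  have hpQ : (p : 𝓞 K) ∈ Q := Ideal.subset_span (by simp)
  have haQ : a + r ∈ Q := Ideal.subset_span (by simp)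
  have hde : (d : 𝓞 K) - r ^ 2 = p * e := by exact_mod_cast congrArg (Int.cast : ℤ → 𝓞 K) he
  have huv' : (u : 𝓞 K) * p + v * (2 * r) = 1 := by exact_mod_cast congrArg (Int.cast : ℤ → 𝓞 K) huv
  have hPQ : P * Q = Ideal.span {(p : 𝓞 K)} := by
    apply le_antisymm
    · rw [hP, hQ, Ideal.span_pair_mul_span_pair, Ideal.span_le]
      rintro x (rfl | rfl | rfl | rfl)
      all_goals rw [SetLike.mem_coe, Ideal.mem_span_singleton]
      · exact dvd_mul_right _ _
      · exact dvd_mul_right _ _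
      · exact dvd_mul_left _ _
      · refine ⟨(e : 𝓞 K), ?_⟩
        linear_combination ha + hde
    · rw [Ideal.span_singleton_le_iff_mem]
      have : (p : 𝓞 K) = u * (p * p) + (v * (p * (a + r)) + (-v) * ((a - r) * p)) := by
        linear_combination (-(p : 𝓞 K)) * huv'
      rw [this]
      exact Ideal.add_mem _ (Ideal.mul_mem_left _ _ (Ideal.mul_mem_mul hpP hpQ))
        (Ideal.add_mem _ (Ideal.mul_mem_left _ _ (Ideal.mul_mem_mul hpP haQ))
          (Ideal.mul_mem_left _ _ (Ideal.mul_mem_mul haP hpQ)))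
  have hcPQ : IsCoprime P Q := by
    rw [Ideal.isCoprime_iff_exists]
    refine ⟨(u : 𝓞 K) * p + (-v) * (a - r), Ideal.add_mem _ (Ideal.mul_mem_left _ _ hpP)
      (Ideal.mul_mem_left _ _ haP), v * (a + r), Ideal.mul_mem_left _ _ haQ, ?_⟩
    linear_combination huv'
  have ht := CN.trace_alpha K d hd a ha
  have htr : ∀ z : ℤ, Algebra.trace ℤ (𝓞 K) (z : 𝓞 K) = 2 * z := by
    intro z
    have := Algebra.trace_algebraMap (R := ℤ) (S := 𝓞 K) z
    rw [RingOfIntegers.rank, hK] at this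
    simpa using this
  have hmul : ∀ x : 𝓞 K, (p : 𝓞 K) ∣ x → (p : ℤ) ∣ Algebra.trace ℤ (𝓞 K) x := by
    rintro x ⟨y, rfl⟩
    refine ⟨Algebra.trace ℤ (𝓞 K) y, ?_⟩
    have : (p : 𝓞 K) * y = (p : ℤ) • y := by simp
    rw [this, map_smul, smul_eq_mul]
  have hNP : Ideal.absNorm P * Ideal.absNorm Q = p ^ 2 := by
    rw [← map_mul, hPQ, CN.norm_nat K hK]
  have hP1 : Ideal.absNorm P ≠ 1 := by
    intro h
    rw [Ideal.absNorm_eq_one_iff] at h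
    have hQ' : Q = Ideal.span {(p : 𝓞 K)} := by rw [← hPQ, h, Ideal.top_mul]
    rw [hQ', Ideal.mem_span_singleton] at haQ
    have := hmul _ haQ
    rw [map_add, ht, htr, zero_add] at this
    exact hr0 this
  have hQ1 : Ideal.absNorm Q ≠ 1 := by
    intro h
    rw [Ideal.absNorm_eq_one_iff] at h
    have hP' : P = Ideal.span {(p : 𝓞 K)} := by rw [← hPQ, h, Ideal.mul_top]
    rw [hP', Ideal.mem_span_singleton] at haP
    have := hmul _ haP
    rw [map_sub, ht, htr, zero_sub, dvd_neg] at this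
    exact hr0 this
  have hN : Ideal.absNorm P = p ∧ Ideal.absNorm Q = p :=
    (hp.mul_eq_prime_sq_iff hP1 hQ1).mp hNP
  have := CN.ic_finite K (p ^ k)
  unfold CN.ic
  rw [← Nat.card_fin (k + 1)]
  refine Nat.card_le_card_of_injective
    (fun i : Fin (k + 1) => ⟨P ^ (i : ℕ) * Q ^ (k - i : ℕ), by
      rw [map_mul, map_pow, map_pow, hN.1, hN.2, ← pow_add]; congr 1; omega⟩) ?_
  have aux : ∀ i j : Fin (k + 1), P ^ (i : ℕ) * Q ^ (k - i : ℕ) = P ^ (j : ℕ) * Q ^ (k - j : ℕ) →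
      (j : ℕ) ≤ i := by
    intro i j hij
    have h1 : P ^ (j : ℕ) ∣ P ^ (i : ℕ) :=
      (hcPQ.pow (m := j) (n := k - i)).dvd_of_dvd_mul_right (hij ▸ dvd_mul_right _ _)
    have h2 := Ideal.absNorm_dvd_absNorm_of_le (Ideal.le_of_dvd h1)
    rw [map_pow, map_pow, hN.1] at h2
    exact (Nat.pow_dvd_pow_iff_le_right hp.one_lt).mp h2
  intro i j hij
  have hij := congrArg Subtype.val hij
  exact Fin.ext (le_antisymm (aux j i hij.symm) (aux i j hij))
end

section
set_option linter.all false
open NumberField ArithmeticFunction Topology Filter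
open scoped ComplexOrder NumberTheorySymbols

/-- comparison coefficients -/
noncomputable def CN.g2 (d : ℤ) [NeZero d] : ArithmeticFunction ℂ :=
  toArithmeticFunction ((1 : DirichletCharacter ℂ 2) ·) * toArithmeticFunction (CN.chi d ·)

lemma CN.g2_mult (d : ℤ) [NeZero d] : (CN.g2 d).IsMultiplicative :=
  (DirichletCharacter.isMultiplicative_toArithmeticFunction _).mul
    (DirichletCharacter.isMultiplicative_toArithmeticFunction _)

lemma CN.g2_prime_pow (d : ℤ) [NeZero d] (p k : ℕ) (hp : p.Prime) :
    CN.g2 d (p ^ k) = ∑ i ∈ Finset.range (k + 1), (1 : DirichletCharacter ℂ 2) p ^ i * CN.chi d p ^ (k - i) := by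
  rw [CN.g2, CN.mul_prime_pow _ _ p hp]
  refine Finset.sum_congr rfl fun i _ => ?_
  rw [CN.toAF_apply _ _ (pow_ne_zero _ hp.ne_zero), CN.toAF_apply _ _ (pow_ne_zero _ hp.ne_zero)]
  simp

lemma CN.g2_le (K : Type) [Field K] [NumberField K] (hK : Module.finrank ℚ K = 2) (d : ℤ) [NeZero d]
    (hd : d < 0) (hsq : Squarefree d) (a : 𝓞 K) (ha : a ^ 2 = (d : 𝓞 K)) (n : ℕ) :
    0 ≤ CN.g2 d n ∧ CN.g2 d n ≤ (CN.ic K n : ℂ) := by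
  induction n using Nat.recOnPosPrimePosCoprime with
  | zero => simp
  | one =>
    rw [(CN.g2_mult d).map_one]
    have := CN.ic_pos (⊤ : Ideal (𝓞 K))
    rw [Ideal.absNorm_top] at this
    exact ⟨zero_le_one, by exact_mod_cast this⟩
  | prime_pow p k hp hk =>
    rw [CN.g2_prime_pow d p k hp]
    by_cases hp2 : p = 2
    · subst hp2
      have h1 : (1 : DirichletCharacter ℂ 2) ((2 : ℕ) : ZMod 2) = 0 := by
        rw [show ((2 : ℕ) : ZMod 2) = 0 from rfl]
        exact MulChar.map_nonunit _ (by simp)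
      have h2 : CN.chi d ((2 : ℕ) : ZMod (4 * d.natAbs)) = 0 := by
        rw [CN.chi_apply, if_neg (by decide)]
      rw [h1, h2]
      have : ∑ i ∈ Finset.range (k + 1), (0 : ℂ) ^ i * 0 ^ (k - i) = 0 := by
        refine Finset.sum_eq_zero fun i _ => ?_
        rw [← pow_add, zero_pow]; omega
      rw [this]
      exact ⟨le_rfl, Nat.cast_nonneg _⟩
    have hodd : Odd p := hp.odd_of_ne_two hp2
    have h1 : (1 : DirichletCharacter ℂ 2) (p : ZMod 2) = 1 := by
      have : (p : ZMod 2) = 1 := (ZMod.natCast_eq_one_iff_odd).mpr hodd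
      rw [this, map_one]
    rw [h1]
    simp only [one_pow, one_mul]
    rw [← Finset.sum_range_reflect]
    have e : ∑ j ∈ Finset.range (k + 1), CN.chi d (p : ZMod (4 * d.natAbs)) ^ (k - (k + 1 - 1 - j))
        = ∑ j ∈ Finset.range (k + 1), CN.chi d (p : ZMod (4 * d.natAbs)) ^ j := by
      refine Finset.sum_congr rfl fun j hj => ?_
      have : j ≤ k := by simpa [Nat.lt_succ_iff] using hj
      congr 1; omega
    rw [e, CN.chi_apply, if_pos hodd]
    have : Fact p.Prime := ⟨hp⟩
    rw [← jacobiSym.legendreSym.to_jacobiSym]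
    by_cases hpd : (p : ℤ) ∣ d
    · have h0 : legendreSym p d = 0 := (legendreSym.eq_zero_iff p d).mpr ((ZMod.intCast_zmod_eq_zero_iff_dvd d p).mpr hpd)
      have h3 := CN.ic_ram K hK d hsq a ha p k hp hpd
      rw [h0, Finset.sum_range_succ']
      simp
      exact_mod_cast h3
    have hpd0 : (d : ZMod p) ≠ 0 := fun h => hpd ((ZMod.intCast_zmod_eq_zero_iff_dvd d p).mp h)
    rcases legendreSym.eq_one_or_neg_one p hpd0 with h0 | h0
    · rw [h0]
      obtain ⟨r, hr⟩ := (legendreSym.eq_one_iff p hpd0).mp h0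
      have hr1 : (p : ℤ) ∣ d - (r.val : ℤ) ^ 2 := by
        rw [← ZMod.intCast_zmod_eq_zero_iff_dvd]
        push_cast
        rw [ZMod.natCast_zmod_val, hr]; ring
      have hr2 : ¬ (p : ℤ) ∣ 2 * (r.val : ℤ) := by
        intro h
        have hpp : Prime (p : ℤ) := Nat.prime_iff_prime_int.mp hp
        rcases hpp.dvd_or_dvd h with h | h
        · have : p ∣ 2 := by exact_mod_cast h
          exact hp2 ((Nat.prime_dvd_prime_iff_eq hp Nat.prime_two).mp this)
        · have h' := (ZMod.intCast_zmod_eq_zero_iff_dvd _ p).mpr h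
          push_cast at h'
          rw [ZMod.natCast_zmod_val] at h'
          exact hpd0 (by rw [hr, h']; ring)
      have h3 := CN.ic_split K hK d hd a ha p k hp _ hr1 hr2
      have e2 : ∑ j ∈ Finset.range (k + 1), (((1 : ℤ) : ℂ)) ^ j = ((k + 1 : ℕ) : ℂ) := by simp
      rw [e2]
      exact ⟨Nat.cast_nonneg _, Nat.cast_le.mpr h3⟩
    · rw [h0]
      push_cast
      rw [neg_one_geom_sum]
      split_ifs with hev
      · exact ⟨le_rfl, Nat.cast_nonneg _⟩
      · have : Even k := by rw [Nat.even_add_one] at hev; simpa using hev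
        exact ⟨zero_le_one, by exact_mod_cast CN.ic_inert K hK p k this⟩
  | coprime m n hm hn hmn ihm ihn =>
    rw [(CN.g2_mult d).map_mul_of_coprime hmn]
    refine ⟨mul_nonneg ihm.1 ihn.1, ?_⟩
    calc CN.g2 d m * CN.g2 d n ≤ (CN.ic K m : ℂ) * (CN.ic K n : ℂ) :=
          mul_le_mul ihm.2 ihn.2 ihn.1 (Nat.cast_nonneg _)
      _ ≤ _ := by exact_mod_cast CN.ic_mul K m n hmn

lemma CN.g2_summable (d : ℤ) [NeZero d] {s : ℂ} (hs : 1 < s.re) : LSeriesSummable (CN.g2 d) s :=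
  ArithmeticFunction.LSeriesSummable_mul (CN.toAF_summable _ hs) (CN.toAF_summable _ hs)

lemma CN.g2_LSeries (d : ℤ) [NeZero d] {s : ℂ} (hs : 1 < s.re) :
    LSeries (CN.g2 d) s = (1 : DirichletCharacter ℂ 2).LFunction s * (CN.chi d).LFunction s := by
  rw [CN.g2, ArithmeticFunction.LSeries_mul' (CN.toAF_summable _ hs) (CN.toAF_summable _ hs),
    CN.toAF_LSeries _ hs, CN.toAF_LSeries _ hs]

lemma CN.ic_summable (K : Type) [Field K] [NumberField K] {s : ℂ} (hs : 1 < s.re) :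
    LSeriesSummable (fun n => (CN.ic K n : ℂ)) s := by
  have ht : Tendsto (fun n : ℕ => (∑ k ∈ Finset.Icc 1 n, (CN.ic K k : ℝ)) / n) atTop (𝓝 (dedekindZeta_residue K)) := by
    refine ((Ideal.tendsto_norm_le_div_atTop₀ K).comp tendsto_natCast_atTop_atTop).congr fun n ↦ ?_
    simp only [Function.comp_apply, Nat.cast_le, ← Nat.cast_sum]
    congr
    rw [← add_left_inj 1, ← Ideal.card_norm_le_eq_card_norm_le_add_one,
      show Finset.Icc 1 n = Finset.Ioc 0 n from Finset.Icc_succ_left_eq_Ioc _ _,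
      show 1 = CN.ic K 0 by simp [CN.ic, Ideal.absNorm_eq_zero_iff],
      Finset.sum_Ioc_add_eq_sum_Icc (n.zero_le)]
    unfold CN.ic
    rw [
      ← Finset.card_preimage_eq_sum_card_image_eq (fun k _ ↦ Ideal.finite_setOfPred_absNorm_eq k)]
    simp [Set.coe_eq_subtype]
  have := LSeriesSummable_of_sum_norm_bigO_and_nonneg (f := fun n => (CN.ic K n : ℝ)) (r := 1) (s := s) ?_
    (fun n => Nat.cast_nonneg _) zero_le_one hs
  · simpa using this
  · have h1 := ht.isBigO_one ℝ
    have h2 := h1.mul (Asymptotics.isBigO_refl (fun n : ℕ => (n : ℝ)) atTop)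
    refine h2.congr' ?_ ?_
    · filter_upwards [eventually_ge_atTop 1] with n hn
      have : (n : ℝ) ≠ 0 := by positivity
      field_simp
    · filter_upwards with n; simp

lemma CN.L_le_residue (K : Type) [Field K] [NumberField K] (hK : Module.finrank ℚ K = 2) (d : ℤ) [NeZero d]
    (hd : d < -1) (hsq : Squarefree d) (a : 𝓞 K) (ha : a ^ 2 = (d : 𝓞 K)) :
    ((CN.chi d).LFunction 1).re ≤ 2 * dedekindZeta_residue K := by
  have hne := CN.chi_ne_one_sqf d hsq hd
  have h1 := tendsto_sub_one_mul_dedekindZeta_nhdsGT K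
  have h2 := DirichletCharacter.LFunctionTrivChar_residue_one (N := 2)
  have hmap : Tendsto (fun x : ℝ => (x : ℂ)) (𝓝[>] 1) (𝓝[≠] (1 : ℂ)) := by
    refine tendsto_nhdsWithin_iff.mpr ⟨?_, ?_⟩
    · have := Complex.continuous_ofReal.tendsto 1
      simp only [Complex.ofReal_one] at this
      exact this.mono_left nhdsWithin_le_nhds
    · filter_upwards [self_mem_nhdsWithin] with x hx
      have : x ≠ 1 := ne_of_gt hx
      simpa using this
  have h3 := h2.comp hmap
  have h4 : Tendsto (fun x : ℝ => (CN.chi d).LFunction (x : ℂ)) (𝓝[>] 1) (𝓝 ((CN.chi d).LFunction 1)) :=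
    ((DirichletCharacter.differentiable_LFunction hne).continuous.tendsto 1).comp
      (hmap.mono_right nhdsWithin_le_nhds)
  have h5 := (Complex.continuous_re.tendsto _).comp (h3.mul h4)
  have h6 := (Complex.continuous_re.tendsto _).comp h1
  have hle := le_of_tendsto_of_tendsto h5 h6 (by
    filter_upwards [self_mem_nhdsWithin] with x hx
    have hx : 1 < x := hx
    have hx' : 1 < (x : ℂ).re := by simpa using hx
    have hL : LSeries (CN.g2 d) x ≤ dedekindZeta K x := by
      refine Summable.tsum_le_tsum (fun n => ?_) (CN.g2_summable d hx') (CN.ic_summable K hx')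
      have := LSeries.term_nonneg (a := fun n => (CN.ic K n : ℂ) - CN.g2 d n)
        (n := n) (sub_nonneg.mpr (CN.g2_le K hK d (by omega) hsq a ha n).2) x
      rw [show (fun n => (CN.ic K n : ℂ) - CN.g2 d n) = (fun n => (CN.ic K n : ℂ)) - (CN.g2 d : ℕ → ℂ) from rfl,
        LSeries.term_sub_apply] at this
      exact sub_nonneg.mp this
    rw [CN.g2_LSeries d hx'] at hL
    have hre := (Complex.le_def.mp hL).1
    simp only [Function.comp_apply, DirichletCharacter.LFunctionTrivChar]
    rw [mul_assoc, show ((x : ℂ) - 1) = ((x - 1 : ℝ) : ℂ) by push_cast; ring, Complex.re_ofReal_mul,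
      Complex.re_ofReal_mul]
    exact mul_le_mul_of_nonneg_left hre (by linarith))
  rw [Nat.Prime.primeFactors Nat.prime_two, Finset.prod_singleton] at hle
  rw [show (1 - ((2 : ℕ) : ℂ)⁻¹) = ((1/2 : ℝ) : ℂ) by push_cast; norm_num, Complex.re_ofReal_mul,
    Complex.ofReal_re] at hle
  linarith
end

section
set_option linter.all false
open NumberField Polynomial

lemma CN.exists_int (K : Type) [Field K] [NumberField K] (d : ℤ) (α : K) (h : α ^ 2 = (d : K)) :
    ∃ a : 𝓞 K, a ^ 2 = (d : 𝓞 K) := by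
  have hint : IsIntegral ℤ α := by
    refine ⟨X ^ 2 - C d, monic_X_pow_sub_C _ two_ne_zero, ?_⟩
    rw [eval₂_sub, eval₂_pow, eval₂_X, eval₂_C, h]; simp
  obtain ⟨a, ha⟩ := (IsIntegralClosure.isIntegral_iff (A := 𝓞 K)).mp hint
  refine ⟨a, ?_⟩
  apply FaithfulSMul.algebraMap_injective (𝓞 K) K
  rw [map_pow, map_intCast, ha, h]

lemma CN.tendsto (B : ℕ) : ∃ N : ℤ, N ≤ -1 ∧ ∀ d : ℤ, d < N → Squarefree d →
      ∀ (K : Type) [Field K] [NumberField K],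
        Module.finrank ℚ K = 2 → (∃ α : K, α ^ 2 = (d : K)) →
          B ≤ NumberField.classNumber K := by
  obtain ⟨c, hc, N, hN⟩ := CN.siegel
  obtain ⟨M, hM⟩ := exists_nat_gt ((16 * B / c) ^ 8)
  refine ⟨min N (-1 - (M : ℤ)), by omega, ?_⟩
  rintro d hd hsq K _ _ hK ⟨α, hα⟩
  obtain ⟨a, ha⟩ := CN.exists_int K d α hα
  have : NeZero d := ⟨by omega⟩
  have h1 := hN d (by omega) hsq
  have h2 := CN.L_le_residue K hK d (by omega) hsq a ha
  have h3 := CN.residue_le K hK d (by omega) hsq a ha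
  set D := (d.natAbs : ℝ) with hD
  have hDM : (M : ℝ) ≤ D := by rw [hD]; exact_mod_cast (by omega : M ≤ d.natAbs)
  have hD1 : 1 ≤ D := by rw [hD]; exact_mod_cast (by omega : 1 ≤ d.natAbs)
  have hD0 : 0 < D := by linarith
  have e1 : Real.sqrt D = D ^ (3/8 : ℝ) * D ^ (1/8 : ℝ) := by
    rw [Real.sqrt_eq_rpow, ← Real.rpow_add hD0]; norm_num
  have h4 : 16 * B / c ≤ D ^ (1/8 : ℝ) := by
    have h5 : ((16 * B / c) ^ 8 : ℝ) ≤ D := by linarith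
    have h6 := Real.rpow_le_rpow (by positivity) h5 (show (0:ℝ) ≤ 1/8 by norm_num)
    rwa [← Real.rpow_natCast, ← Real.rpow_mul (by positivity), show ((8 : ℕ) : ℝ) * (1/8) = 1 by norm_num,
      Real.rpow_one] at h6
  rw [div_le_iff₀ hc] at h4
  have hp8 : 0 ≤ D ^ (1/8 : ℝ) := by positivity
  have h7 : c * D ^ (1/8 : ℝ) ≤ ((CN.chi d).LFunction 1).re * Real.sqrt D := by
    rw [e1, ← mul_assoc]; gcongr
  have h8 : ((CN.chi d).LFunction 1).re * Real.sqrt D ≤ 2 * dedekindZeta_residue K * Real.sqrt D := by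
    gcongr
  have hpi := Real.pi_lt_four
  have hh : (0 : ℝ) ≤ classNumber K := by positivity
  have h9 : (16 * B : ℝ) ≤ 16 * classNumber K := by nlinarith
  have : (B : ℝ) ≤ classNumber K := by linarith
  exact_mod_cast this

lemma CN.exists_field (d : ℤ) (hd : d < 0) : ∃ (K : Type) (_ : Field K) (_ : NumberField K),
    Module.finrank ℚ K = 2 ∧ ∃ α : K, α ^ 2 = (d : K) := by
  have hirr : Irreducible (X ^ 2 - C (d : ℚ) : ℚ[X]) := by
    refine (Polynomial.irreducible_iff_roots_eq_zero_of_degree_le_three (by rw [natDegree_X_pow_sub_C])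
      (by rw [natDegree_X_pow_sub_C]; norm_num)).mpr ?_
    rw [Multiset.eq_zero_iff_forall_notMem]
    intro x hx
    have := (Polynomial.mem_roots'.mp hx).2
    simp only [IsRoot.def, eval_sub, eval_pow, eval_X, eval_C] at this
    have hd' : (d : ℚ) < 0 := by exact_mod_cast hd
    nlinarith [sq_nonneg x]
  have hf : Fact (Irreducible (X ^ 2 - C (d : ℚ) : ℚ[X])) := ⟨hirr⟩
  let pb := AdjoinRoot.powerBasis hirr.ne_zero
  have hchar : CharZero (AdjoinRoot (X ^ 2 - C (d : ℚ) : ℚ[X])) := algebraRat.charZero _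
  have hfin : FiniteDimensional ℚ (AdjoinRoot (X ^ 2 - C (d : ℚ) : ℚ[X])) := pb.finite
  refine ⟨AdjoinRoot (X ^ 2 - C (d : ℚ) : ℚ[X]), inferInstance, ?_, ?_, ?_⟩
  · exact @NumberField.mk _ _ hchar (by convert hfin)
  · have := pb.finrank
    rw [AdjoinRoot.powerBasis_dim, natDegree_X_pow_sub_C] at this
    convert this
  · refine ⟨AdjoinRoot.root _, ?_⟩
    have := AdjoinRoot.eval₂_root (X ^ 2 - C (d : ℚ) : ℚ[X])
    rw [eval₂_sub, eval₂_pow, eval₂_X, eval₂_C] at this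
    exact (sub_eq_zero.mp this).trans (map_intCast (AdjoinRoot.of (X ^ 2 - C (d : ℚ) : ℚ[X])) d)
end

/-- For every n ≥ 1, the set of squarefree d < 0 with
h(ℚ(√d)) ≤ n is finite; in particular h(ℚ(√d)) → ∞ as d → −∞ through
squarefree values. -/
theorem class_number_tendsto_infinity (n : ℕ) (hn : 1 ≤ n) :
    ({d : ℤ | d < 0 ∧ Squarefree d ∧
        ∀ (K : Type) [Field K] [NumberField K],
          Module.finrank ℚ K = 2 → (∃ α : K, α ^ 2 = (d : K)) →
            NumberField.classNumber K ≤ n}).Finite ∧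
    ∀ B : ℕ, ∃ N : ℤ, ∀ d : ℤ, d < N → Squarefree d →
      ∀ (K : Type) [Field K] [NumberField K],
        Module.finrank ℚ K = 2 → (∃ α : K, α ^ 2 = (d : K)) →
          B ≤ NumberField.classNumber K := by
  refine ⟨?_, ?_⟩
  · obtain ⟨N, hN1, hN⟩ := CN.tendsto (n + 1)
    refine (Set.finite_Ico N 0).subset ?_
    rintro d ⟨hd, hsq, hK⟩
    refine ⟨?_, hd⟩
    by_contra hlt
    obtain ⟨K, i1, i2, hr, hα⟩ := CN.exists_field d hd
    have h1 := hK K hr hα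
    have h2 := hN d (by omega) hsq K hr hα
    omega
  · intro B
    obtain ⟨N, _, hN⟩ := CN.tendsto B
    exact ⟨N, hN⟩
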